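/- arXiv:0903.5399 — 4 statements merged into one kernel-verified Lean document; each statement's English description precedes it below -/
import Mathlib

section
/- For a one-dimensional left-truncated exponential family, the Shtarkov integral is finite if and only if there exists a distribution Q_dom with sup_{β ∈ Γ} D(P_β ‖ Q_dom) < ∞ (a dominating distribution in the sense of information divergence). -/
open scoped ENNReal NNReal
open MeasureTheory Real Set Filter Topology Asymptotics ProbabilityTheory

noncomputable section

/-- Partition function of the exponential family generated by `Q`. -/
def Z (Q : Measure ℝ) (β : ℝ) : ℝ≥0∞ := ∫⁻ x, ENNReal.ofReal (Real.exp (β * x)) ∂Q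

/-- Canonical parameter space. -/
def Γcan (Q : Measure ℝ) : Set ℝ := {β | Z Q β < ⊤}

/-- The member of the exponential family with canonical parameter `β`:
`dP_β/dQ = e^{βx}/Z(β)`. -/
def Pexp (Q : Measure ℝ) (β : ℝ) : Measure ℝ :=
  Q.withDensity (fun x => ENNReal.ofReal (Real.exp (β * x)) / Z Q β)

/-- Log-partition function. -/
def ψ (Q : Measure ℝ) (β : ℝ) : ℝ := Real.log (Z Q β).toReal

open Classical in
/-- Kullback–Leibler divergence (in nats), valued in `ℝ≥0∞`. -/
def KL (P Q' : Measure ℝ) : ℝ≥0∞ :=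
  if P ≪ Q' ∧ Integrable (fun x => Real.log (P.rnDeriv Q' x).toReal) P
  then ENNReal.ofReal (∫ x, Real.log (P.rnDeriv Q' x).toReal ∂P) else ⊤

/-- `Q` is supported on a half-line bounded below (left-truncated family). -/
def LeftTruncated (Q : Measure ℝ) : Prop := ∃ a : ℝ, ∀ᵐ x ∂Q, a ≤ x
/-- Shtarkov integral of the exponential family generated by Q. -/
def Shtarkov (Q : Measure ℝ) : ℝ≥0∞ :=
  ∫⁻ x, ⨆ β ∈ Γcan Q, ENNReal.ofReal (Real.exp (β * x)) / Z Q β ∂Q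


lemma negpart_le (P Q' : Measure ℝ) [IsProbabilityMeasure P] [IsProbabilityMeasure Q']
    (hac : P ≪ Q') :
    ∫⁻ x, ENNReal.ofReal (-Real.log (P.rnDeriv Q' x).toReal) ∂P ≤ 1 := by
  have hm : Measurable (P.rnDeriv Q') := Measure.measurable_rnDeriv P Q'
  have hP : ∫⁻ x, ENNReal.ofReal (-Real.log (P.rnDeriv Q' x).toReal) ∂P
      = ∫⁻ x, P.rnDeriv Q' x * ENNReal.ofReal (-Real.log (P.rnDeriv Q' x).toReal) ∂Q' := by
    conv_lhs => rw [← Measure.withDensity_rnDeriv_eq P Q' hac]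
    rw [lintegral_withDensity_eq_lintegral_mul _ hm (by fun_prop)]
    rw [Measure.withDensity_rnDeriv_eq P Q' hac]
    rfl
  rw [hP]
  calc _ ≤ ∫⁻ x, 1 ∂Q' := by
        apply lintegral_mono_ae
        filter_upwards [Measure.rnDeriv_lt_top P Q'] with x hx
        generalize P.rnDeriv Q' x = t at hx
        lift t to ℝ≥0 using hx.ne
        rw [ENNReal.coe_toReal]
        rcases eq_or_ne t 0 with h0 | h0
        · simp [h0]
        have ht : (0:ℝ) < t := by positivity
        have h1 : -Real.log t ≤ 1 / t := by
          have := Real.log_le_sub_one_of_pos (inv_pos.2 ht)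
          rw [Real.log_inv] at this
          rw [one_div]; linarith
        calc (t : ℝ≥0∞) * ENNReal.ofReal (-Real.log t) ≤ t * ENNReal.ofReal (1/t) := by gcongr
          _ = 1 := by
            rw [← ENNReal.ofReal_coe_nnreal, ← ENNReal.ofReal_mul ht.le]
            rw [mul_one_div_cancel ht.ne', ENNReal.ofReal_one]
    _ = 1 := by simp

lemma KL_le_of_le (P Q' : Measure ℝ) [IsProbabilityMeasure P] [IsProbabilityMeasure Q']
    (c : ℝ≥0) (hc : c ≠ 0) (h : P ≤ c • Q') : KL P Q' ≤ ENNReal.ofReal (Real.log c) := by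
  have hac : P ≪ Q' :=
    (Measure.absolutelyContinuous_of_le h).trans (Measure.smul_absolutelyContinuous)
  have hm : Measurable (P.rnDeriv Q') := Measure.measurable_rnDeriv P Q'
  have hf : ∀ᵐ x ∂Q', P.rnDeriv Q' x ≤ c := by
    refine ae_le_of_forall_setLIntegral_le_of_sigmaFinite hm fun s _ _ ↦ ?_
    refine (Measure.setLIntegral_rnDeriv_le s).trans ((h s).trans ?_)
    rw [setLIntegral_const]; rfl
  have hle : ∀ᵐ x ∂P, Real.log (P.rnDeriv Q' x).toReal ≤ Real.log c := by
    filter_upwards [hac.ae_le hf, Measure.rnDeriv_pos hac] with x hx hx0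
    apply Real.log_le_log
    · exact ENNReal.toReal_pos hx0.ne' (hx.trans_lt ENNReal.coe_lt_top).ne
    · exact ENNReal.toReal_mono ENNReal.coe_ne_top hx
  have hint : Integrable (fun x => Real.log (P.rnDeriv Q' x).toReal) P := by
    refine ⟨(hm.ennreal_toReal.log).aestronglyMeasurable, ?_⟩
    rw [hasFiniteIntegral_iff_norm]
    have : ∀ᵐ x ∂P, ENNReal.ofReal ‖Real.log (P.rnDeriv Q' x).toReal‖ ≤
        ENNReal.ofReal (Real.log c) + ENNReal.ofReal (-Real.log (P.rnDeriv Q' x).toReal) := by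
      filter_upwards [hle] with x hx
      rcases abs_cases (Real.log (P.rnDeriv Q' x).toReal) with h | h
      · rw [Real.norm_eq_abs, h.1]
        exact (ENNReal.ofReal_le_ofReal hx).trans le_self_add
      · rw [Real.norm_eq_abs, h.1]
        exact le_add_self
    refine (lintegral_mono_ae this).trans_lt ?_
    rw [lintegral_add_left measurable_const]
    refine ENNReal.add_lt_top.2 ⟨by simp, (negpart_le P Q' hac).trans_lt (by simp)⟩
  rw [KL, if_pos ⟨hac, hint⟩]
  apply ENNReal.ofReal_le_ofReal
  calc _ ≤ ∫ x, Real.log c ∂P := integral_mono_ae hint (integrable_const _) hle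
    _ = _ := by simp

lemma KL_small (C : ℝ) (hC : 0 ≤ C) : ∃ δ : ℝ≥0∞, 0 < δ ∧ ∀ (P Q' : Measure ℝ),
    IsProbabilityMeasure P → IsProbabilityMeasure Q' → KL P Q' ≤ ENNReal.ofReal C →
    ∀ A, MeasurableSet A → Q' A < δ → P A < 1/2 := by
  set L : ℝ := 4 * (C+1) with hL
  refine ⟨ENNReal.ofReal (1/4 * Real.exp (-L)), by positivity, ?_⟩
  intro P Q' _ _ hKL A hA hQA
  have hcond : P ≪ Q' ∧ Integrable (fun x => Real.log (P.rnDeriv Q' x).toReal) P := by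
    by_contra hn
    rw [KL, if_neg hn] at hKL
    simp at hKL
  rw [KL, if_pos hcond] at hKL
  obtain ⟨hac, hint⟩ := hcond
  have hm : Measurable (P.rnDeriv Q') := Measure.measurable_rnDeriv P Q'
  have h1 := (ENNReal.ofReal_le_ofReal_iff hC).1 hKL
  rw [integral_eq_lintegral_pos_part_sub_lintegral_neg_part hint] at h1
  have h2 := negpart_le P Q' hac
  have h2' := ENNReal.toReal_mono (by simp) h2
  set I := ∫⁻ x, ENNReal.ofReal (Real.log (P.rnDeriv Q' x).toReal) ∂P with hI
  have hIfin : I ≠ ⊤ := by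
    have := hint.2
    rw [hasFiniteIntegral_iff_norm] at this
    refine ((lintegral_mono fun x => ?_).trans_lt this).ne
    exact ENNReal.ofReal_le_ofReal (le_abs_self _)
  have hI1 : I ≤ ENNReal.ofReal (C+1) := by
    rw [← ENNReal.ofReal_toReal hIfin]
    apply ENNReal.ofReal_le_ofReal
    simp at h2'
    linarith
  set B : Set ℝ := {x | ENNReal.ofReal L ≤ ENNReal.ofReal (Real.log (P.rnDeriv Q' x).toReal)}
  have hB : P B ≤ 1/4 := by
    have := mul_meas_ge_le_lintegral (μ := P) (f := fun x => ENNReal.ofReal (Real.log (P.rnDeriv Q' x).toReal)) (by fun_prop) (ENNReal.ofReal L)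
    have h3 := this.trans hI1
    have h4 : ENNReal.ofReal (C+1) = ENNReal.ofReal L * (1/4) := by
      rw [show (1/4 : ℝ≥0∞) = ENNReal.ofReal (1/4) by
        rw [ENNReal.ofReal_div_of_pos (by norm_num)]; simp]
      rw [← ENNReal.ofReal_mul (by positivity)]
      congr 1; rw [hL]; ring
    rw [h4] at h3
    exact (ENNReal.mul_le_mul_iff_right (by simp [hL]; linarith) (by simp)).1 h3
  have hAB : P (A \ B) < 1/4 := by
    have hBm : MeasurableSet B := by
      apply measurableSet_le <;> fun_prop
    have : P (A \ B) ≤ ENNReal.ofReal (Real.exp L) * Q' A := by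
      conv_lhs => rw [← Measure.withDensity_rnDeriv_eq P Q' hac]
      rw [withDensity_apply _ (hA.diff hBm)]
      calc _ ≤ ∫⁻ x in A \ B, ENNReal.ofReal (Real.exp L) ∂Q' := by
            apply setLIntegral_mono_ae measurable_const.aemeasurable
            filter_upwards [Measure.rnDeriv_lt_top P Q'] with x hx hxm
            have hx2 : ¬ _ := hxm.2
            simp only [B, mem_ofPred_eq, not_le] at hx2
            rw [ENNReal.ofReal_lt_ofReal_iff (by positivity)] at hx2
            rw [← ENNReal.ofReal_toReal hx.ne]
            apply ENNReal.ofReal_le_ofReal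
            rcases (ENNReal.toReal_nonneg (a := P.rnDeriv Q' x)).eq_or_lt with h0 | h0
            · rw [← h0]; positivity
            · exact ((Real.log_lt_iff_lt_exp h0).1 hx2).le
        _ ≤ _ := by
            rw [setLIntegral_const]
            gcongr
            exact sdiff_subset
    refine this.trans_lt ?_
    calc _ < ENNReal.ofReal (Real.exp L) * ENNReal.ofReal (1/4 * Real.exp (-L)) := by
          rw [ENNReal.mul_lt_mul_iff_right (by positivity) (by simp)]
          exact hQA
      _ = 1/4 := by
          rw [← ENNReal.ofReal_mul (by positivity), mul_left_comm, ← Real.exp_add]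
          rw [ENNReal.ofReal_mul (by positivity), ENNReal.ofReal_div_of_pos (by norm_num)]
          simp
  calc P A ≤ P (B ∪ (A \ B)) := measure_mono (by intro x hx; by_cases h : x ∈ B <;> simp [h, hx])
    _ ≤ P B + P (A \ B) := measure_union_le _ _
    _ < 1/4 + 1/4 := ENNReal.add_lt_add_of_le_of_lt (by finiteness) hB hAB
    _ = 1/2 := by
      rw [ENNReal.div_add_div_same, ENNReal.div_eq_div_iff] <;> norm_num

lemma Z_ne_zero (Q : Measure ℝ) [IsProbabilityMeasure Q] (β : ℝ) : Z Q β ≠ 0 := by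
  rw [Z, Ne, lintegral_eq_zero_iff (by fun_prop)]
  intro h
  have : ∀ᵐ x ∂Q, False := by
    filter_upwards [h] with x hx
    have := Real.exp_pos (β * x)
    simp at hx
    linarith
  exact IsProbabilityMeasure.ne_zero Q (by simpa using this)

lemma Z_zero (Q : Measure ℝ) [IsProbabilityMeasure Q] : Z Q 0 = 1 := by simp [Z]

lemma zero_mem (Q : Measure ℝ) [IsProbabilityMeasure Q] : (0:ℝ) ∈ Γcan Q := by
  show Z Q 0 < ⊤
  simp [Z_zero]

lemma Pexp_prob (Q : Measure ℝ) [IsProbabilityMeasure Q] {β : ℝ} (hβ : β ∈ Γcan Q) :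
    IsProbabilityMeasure (Pexp Q β) := by
  refine ⟨?_⟩
  rw [Pexp, withDensity_apply _ MeasurableSet.univ, Measure.restrict_univ]
  simp_rw [ENNReal.div_eq_inv_mul]
  rw [lintegral_const_mul _ (by fun_prop)]
  exact ENNReal.inv_mul_cancel (Z_ne_zero Q β) (ne_of_lt hβ)

lemma sht_measurable (Q : Measure ℝ) [IsProbabilityMeasure Q] : Measurable
    (fun x => ⨆ β ∈ Γcan Q, ENNReal.ofReal (Real.exp (β * x)) / Z Q β) := by
  apply LowerSemicontinuous.measurable
  apply lowerSemicontinuous_biSup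
  intro β _
  apply Continuous.lowerSemicontinuous
  simp_rw [ENNReal.div_eq_inv_mul]
  apply ENNReal.continuous_const_mul _ |>.comp
    (ENNReal.continuous_ofReal.comp (by fun_prop))
  simp [Z_ne_zero]

lemma forward (Q : Measure ℝ) [IsProbabilityMeasure Q] (h : Shtarkov Q < ⊤) :
      ∃ Qdom : Measure ℝ, IsProbabilityMeasure Qdom ∧
        (⨆ β ∈ Γcan Q, KL (Pexp Q β) Qdom) < ⊤ := by
  set s : ℝ → ℝ≥0∞ := fun x => ⨆ β ∈ Γcan Q, ENNReal.ofReal (Real.exp (β * x)) / Z Q β with hs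
  have hsm : Measurable s := sht_measurable Q
  have hS1 : 1 ≤ Shtarkov Q := by
    calc (1:ℝ≥0∞) = ∫⁻ x, 1 ∂Q := by simp
      _ ≤ _ := by
        apply lintegral_mono
        intro x
        refine le_trans ?_ (le_iSup₂ (f := fun β (_ : β ∈ Γcan Q) => ENNReal.ofReal (Real.exp (β * x)) / Z Q β) 0 (zero_mem Q))
        simp [Z_zero]
  have hS0 : Shtarkov Q ≠ 0 := (lt_of_lt_of_le one_pos hS1).ne'
  have hSc : ((Shtarkov Q).toNNReal : ℝ≥0∞) = Shtarkov Q := ENNReal.coe_toNNReal h.ne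
  set D : Measure ℝ := (Shtarkov Q)⁻¹ • Q.withDensity s with hD
  have hDp : IsProbabilityMeasure D := by
    refine ⟨?_⟩
    rw [hD, Measure.smul_apply, withDensity_apply _ MeasurableSet.univ, Measure.restrict_univ]
    exact ENNReal.inv_mul_cancel hS0 h.ne
  refine ⟨D, hDp, ?_⟩
  refine lt_of_le_of_lt (b := ENNReal.ofReal (Real.log (Shtarkov Q).toNNReal)) ?_ (by simp)
  refine iSup₂_le fun β hβ => ?_
  have := Pexp_prob Q hβ
  apply KL_le_of_le
  · simp [ENNReal.toNNReal_eq_zero_iff, hS0, h.ne]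
  · have : (Shtarkov Q).toNNReal • D = Q.withDensity s := by
      rw [hD]
      ext A hA
      rw [Measure.smul_apply, Measure.smul_apply, ENNReal.smul_def, hSc]
      simp only [smul_eq_mul]
      rw [← mul_assoc, ENNReal.mul_inv_cancel hS0 h.ne, one_mul]
    rw [this, Pexp]
    apply withDensity_mono
    refine ae_of_all _ fun x => ?_
    exact le_iSup₂ (f := fun β (_ : β ∈ Γcan Q) => ENNReal.ofReal (Real.exp (β * x)) / Z Q β) β hβ

/-- Uniform smallness. -/
lemma unif_small (Q : Measure ℝ) [IsProbabilityMeasure Q]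
    (h : ∃ Qdom : Measure ℝ, IsProbabilityMeasure Qdom ∧
        (⨆ β ∈ Γcan Q, KL (Pexp Q β) Qdom) < ⊤)
    (A : ℕ → Set ℝ) (hA : ∀ n, MeasurableSet (A n)) (hanti : Antitone A) (hempty : ⋂ n, A n = ∅) :
    ∃ n, ∀ β ∈ Γcan Q, Pexp Q β (A n) < 1/2 := by
  obtain ⟨D, hD, hlt⟩ := h
  obtain ⟨δ, hδ, hsm⟩ := KL_small (⨆ β ∈ Γcan Q, KL (Pexp Q β) D).toReal ENNReal.toReal_nonneg
  rw [ENNReal.ofReal_toReal hlt.ne] at hsm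
  have ht := tendsto_measure_iInter_atTop (μ := D) (fun n => (hA n).nullMeasurableSet) hanti
    ⟨0, by finiteness⟩
  rw [hempty, measure_empty] at ht
  obtain ⟨n, hn⟩ := (ht.eventually (gt_mem_nhds hδ)).exists
  exact ⟨n, fun β hβ => hsm _ _ (Pexp_prob Q hβ) hD
    (le_iSup₂ (f := fun β (_ : β ∈ Γcan Q) => KL (Pexp Q β) D) β hβ) _ (hA n) hn⟩

lemma Z_upper (Q : Measure ℝ) [IsProbabilityMeasure Q] {β : ℝ} (hβ : β ∈ Γcan Q) {A : Set ℝ}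
    (hA : MeasurableSet A) (h : Pexp Q β A < 1/2) (c : ℝ)
    (hc : ∀ᵐ x ∂Q, x ∉ A → β * x ≤ β * c) :
    Z Q β ≤ ENNReal.ofReal (2 * Real.exp (β * c)) := by
  have := Pexp_prob Q hβ
  have h1 : 1/2 ≤ Pexp Q β Aᶜ := by
    by_contra hn
    rw [not_le] at hn
    have := measure_union_le (μ := Pexp Q β) A Aᶜ
    rw [union_compl_self, measure_univ] at this
    have h3 := this.trans_lt (ENNReal.add_lt_add h hn)
    rw [ENNReal.add_halves] at h3
    exact lt_irrefl _ h3
  rw [Pexp, withDensity_apply _ hA.compl] at h1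
  have h2 : ∫⁻ x in Aᶜ, ENNReal.ofReal (Real.exp (β * x)) / Z Q β ∂Q ≤
      ENNReal.ofReal (Real.exp (β * c)) / Z Q β := by
    calc _ ≤ ∫⁻ x in Aᶜ, ENNReal.ofReal (Real.exp (β * c)) / Z Q β ∂Q := by
          apply setLIntegral_mono_ae measurable_const.aemeasurable
          filter_upwards [hc] with x hx hxA
          exact ENNReal.div_le_div_right
            (ENNReal.ofReal_le_ofReal (Real.exp_le_exp.2 (hx hxA))) _
      _ ≤ _ := by
          rw [setLIntegral_const]
          exact mul_le_of_le_one_right' prob_le_one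
  have h3 := h1.trans h2
  rw [ENNReal.le_div_iff_mul_le (Or.inl (Z_ne_zero Q β)) (Or.inl (ne_of_lt hβ))] at h3
  calc Z Q β = 2 * (1/2 * Z Q β) := by
        rw [← mul_assoc, one_div, ENNReal.mul_inv_cancel (by simp) (by simp), one_mul]
    _ ≤ 2 * ENNReal.ofReal (Real.exp (β * c)) := by gcongr
    _ = _ := by rw [ENNReal.ofReal_mul (by simp)]; simp

lemma Z_lower (Q : Measure ℝ) [IsProbabilityMeasure Q] (β : ℝ) {D : Set ℝ}
    (hD : MeasurableSet D) (d : ℝ) (hd : ∀ x ∈ D, β * d ≤ β * x) :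
    ENNReal.ofReal (Real.exp (β * d)) * Q D ≤ Z Q β := by
  rw [← setLIntegral_const]
  refine le_trans ?_ (setLIntegral_le_lintegral D _)
  apply setLIntegral_mono (by fun_prop)
  intro x hx
  exact ENNReal.ofReal_le_ofReal (Real.exp_le_exp.2 (hd x hx))

lemma D_bound (Q : Measure ℝ) [IsProbabilityMeasure Q] {β : ℝ} (hβ : β ∈ Γcan Q) {A D : Set ℝ}
    (hA : MeasurableSet A) (h : Pexp Q β A < 1/2) (c : ℝ)
    (hc : ∀ᵐ x ∂Q, x ∉ A → β * x ≤ β * c)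
    (hD : MeasurableSet D) (d : ℝ) (hd : ∀ x ∈ D, β * d ≤ β * x) :
    Q.real D ≤ 2 * Real.exp (β * (c - d)) := by
  have h1 := (Z_lower Q β hD d hd).trans (Z_upper Q hβ hA h c hc)
  rw [← ofReal_measureReal, ← ENNReal.ofReal_mul (by positivity),
    ENNReal.ofReal_le_ofReal_iff (by positivity)] at h1
  have : Real.exp (β * c) = Real.exp (β * (c - d)) * Real.exp (β * d) := by
    rw [← Real.exp_add]; ring_nf
  rw [this] at h1
  have h0 := Real.exp_pos (β * d)
  nlinarith

/-- Pointwise density bound. -/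
lemma dens_atom (Q : Measure ℝ) [IsProbabilityMeasure Q] (β c x : ℝ) (h : β * x ≤ β * c)
    (hc : Q {c} ≠ 0) :
    ENNReal.ofReal (Real.exp (β * x)) / Z Q β ≤ (Q {c})⁻¹ := by
  have h1 := Z_lower Q β (measurableSet_singleton c) c (by simp)
  calc _ ≤ ENNReal.ofReal (Real.exp (β * c)) / (ENNReal.ofReal (Real.exp (β * c)) * Q {c}) := by
        gcongr
    _ = _ := by
        rw [ENNReal.div_eq_inv_mul, ENNReal.mul_inv (by simp) (by simp), mul_right_comm,
          ENNReal.inv_mul_cancel (by positivity) (by simp), one_mul]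

lemma neg_mem (Q : Measure ℝ) [IsProbabilityMeasure Q] (a : ℝ) (β : ℝ)
    (h : ∀ᵐ x ∂Q, β * x ≤ a) : β ∈ Γcan Q := by
  show Z Q β < ⊤
  calc Z Q β ≤ ∫⁻ x, ENNReal.ofReal (Real.exp a) ∂Q := by
        apply lintegral_mono_ae
        filter_upwards [h] with x hx
        gcongr
    _ < ⊤ := by simp

lemma strip_meas (σ p q : ℝ) : MeasurableSet {x : ℝ | p < σ * x ∧ σ * x < q} := by
  have h1 : MeasurableSet {x : ℝ | p < σ * x} := measurableSet_lt (by fun_prop) (by fun_prop)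
  have h2 : MeasurableSet {x : ℝ | σ * x < q} := measurableSet_lt (by fun_prop) (by fun_prop)
  exact h1.inter h2

/-- End atoms: `σ = -1` for the left end, `σ = 1` for the right end. -/
lemma end_atom (Q : Measure ℝ) [IsProbabilityMeasure Q]
    (h : ∃ Qdom : Measure ℝ, IsProbabilityMeasure Qdom ∧
        (⨆ β ∈ Γcan Q, KL (Pexp Q β) Qdom) < ⊤)
    (σ : ℝ) (hσ : σ * σ = 1) (b : ℝ) (hb : ∀ᵐ x ∂Q, σ * x ≤ σ * b) (hsupp : b ∈ Q.support) :
    Q {b} ≠ 0 := by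
  intro hb0
  set u : ℕ → ℝ := fun n => 1 / ((n:ℝ) + 1)
  have hu0 : ∀ n, 0 < u n := fun n => by positivity
  obtain ⟨n, hn⟩ := unif_small Q h
    (fun n => {x | σ * b - u n < σ * x ∧ σ * x < σ * b})
    (fun n => by
      exact strip_meas _ _ _)
    (by
      intro m n hmn x hx
      have : u n ≤ u m := one_div_le_one_div_of_le (by positivity) (by gcongr)
      exact ⟨by have := hx.1; linarith, hx.2⟩)
    (by
      ext x
      simp only [mem_iInter, mem_empty_iff_false, iff_false]
      intro hx
      have h0 : 0 < σ * b - σ * x := by have := (hx 0).2; linarith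
      obtain ⟨n, hn⟩ := exists_nat_one_div_lt h0
      have h1 := (hx n).1
      simp only [u] at h1
      linarith)
  set A : Set ℝ := {x | σ * b - u n < σ * x ∧ σ * x < σ * b}
  have hAm : MeasurableSet A := by
      exact strip_meas _ _ _
  set ε := u n
  have hε : 0 < ε := hu0 n
  set D : Set ℝ := {x | σ * b - ε / 2 < σ * x}
  have hDo : IsOpen D := isOpen_lt (by fun_prop) (by fun_prop)
  have hDpos : 0 < Q D := by
    rw [Measure.mem_support_iff_forall] at hsupp
    exact hsupp D (hDo.mem_nhds (by show σ * b - ε / 2 < σ * b; linarith))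
  have hb' : ∀ᵐ x ∂Q, x ≠ b := by
    rw [ae_iff]; simpa using hb0
  have key : ∀ t : ℝ, 0 ≤ t → Q.real D ≤ 2 * Real.exp (t * (-(ε/2))) := by
    intro t ht
    have := D_bound Q (β := t * σ) (neg_mem Q (t * (σ * b)) _ (by
      filter_upwards [hb] with x hx
      rw [mul_assoc]; gcongr)) hAm (hn _ (neg_mem Q (t * (σ * b)) _ (by
      filter_upwards [hb] with x hx
      rw [mul_assoc]; gcongr))) (b - σ * ε) (by
        filter_upwards [hb, hb'] with x hx hxb hxA
        have hlt : σ * x < σ * b := by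
          refine lt_of_le_of_ne hx fun he => hxb ?_
          have : σ ≠ 0 := by rintro rfl; simp at hσ
          exact mul_left_cancel₀ this he
        have h2 : σ * x ≤ σ * b - ε := by
          by_contra hc
          exact hxA ⟨not_le.1 hc, hlt⟩
        have h3 : t * (σ * x) ≤ t * (σ * b - ε) := by gcongr
        calc t * σ * x = t * (σ * x) := by ring
          _ ≤ _ := h3
          _ = t * σ * b - t * (1 * ε) := by ring
          _ = _ := by rw [← hσ]; ring) hDo.measurableSet (b - σ * (ε/2)) (by
        intro x hx
        have h2 : σ * b - ε/2 ≤ σ * x := le_of_lt hx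
        have h3 : t * (σ * b - ε/2) ≤ t * (σ * x) := by gcongr
        calc _ = t * σ * b - t * ((σ * σ) * (ε/2)) := by ring
          _ = t * (σ * b - ε/2) := by rw [hσ]; ring
          _ ≤ _ := h3
          _ = _ := by ring)
    refine this.trans (le_of_eq ?_)
    congr 2
    calc _ = - t * ((σ * σ) * (ε/2)) := by ring
      _ = _ := by rw [hσ]; ring
  have hlim : Tendsto (fun t : ℝ => 2 * Real.exp (t * (-(ε/2)))) atTop (𝓝 (2 * 0)) := by
    apply Tendsto.const_mul
    apply Real.tendsto_exp_atBot.comp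
    exact tendsto_id.atTop_mul_const_of_neg (by linarith)
  have h5 : Q.real D ≤ 2 * 0 := ge_of_tendsto hlim (eventually_atTop.2 ⟨0, key⟩)
  have h6 : 0 < Q.real D := ENNReal.toReal_pos hDpos.ne' (by finiteness)
  linarith

/-- Unbounded case: the parameter space contains its upper bound. -/
lemma unbdd_max (Q : Measure ℝ) [IsProbabilityMeasure Q]
    (h : ∃ Qdom : Measure ℝ, IsProbabilityMeasure Qdom ∧
        (⨆ β ∈ Γcan Q, KL (Pexp Q β) Qdom) < ⊤)
    (hun : ¬ BddAbove Q.support) : ∃ B ∈ Γcan Q, ∀ β ∈ Γcan Q, β ≤ B := by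
  obtain ⟨n, hn⟩ := unif_small Q h (fun n => Ici (n:ℝ)) (fun n => measurableSet_Ici)
    (by
      intro m n hmn
      exact Ici_subset_Ici.2 (by exact_mod_cast hmn))
    (by
      ext x
      simp only [mem_iInter, mem_Ici, mem_empty_iff_false, iff_false]
      intro hx
      obtain ⟨n, hn⟩ := exists_nat_gt x
      linarith [hx n])
  have hDpos : 0 < Q (Ioi ((n:ℝ)+1)) := by
    rw [not_bddAbove_iff] at hun
    obtain ⟨y, hy, hny⟩ := hun ((n:ℝ)+1)
    rw [Measure.mem_support_iff_forall] at hy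
    exact hy _ (Ioi_mem_nhds hny)
  have hDr : 0 < Q.real (Ioi ((n:ℝ)+1)) := ENNReal.toReal_pos hDpos.ne' (by finiteness)
  have hcc : ∀ β : ℝ, 0 ≤ β → ∀ᵐ x ∂Q, x ∉ Ici (n:ℝ) → β * x ≤ β * n := by
    intro β h0
    refine ae_of_all _ fun x hx => ?_
    simp at hx
    gcongr
  obtain ⟨K, hK⟩ : BddAbove (Γcan Q) := by
    have hlim : Tendsto (fun t : ℝ => 2 * Real.exp (t * (-1))) atTop (𝓝 (2 * 0)) := by
      apply Tendsto.const_mul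
      apply Real.tendsto_exp_atBot.comp
      exact tendsto_id.atTop_mul_const_of_neg (by linarith)
    rw [mul_zero] at hlim
    obtain ⟨K, hK⟩ := eventually_atTop.1 (hlim.eventually (gt_mem_nhds hDr))
    refine ⟨max K 0, fun β hβ => ?_⟩
    by_contra hc
    rw [not_le, max_lt_iff] at hc
    have h1 := D_bound Q hβ measurableSet_Ici (hn β hβ) n (hcc β hc.2.le) (D := Ioi ((n:ℝ)+1)) measurableSet_Ioi
      (n+1) (by
        intro x hx
        have := le_of_lt (mem_Ioi.1 hx)
        have := hc.2
        gcongr)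
    have h2 := hK β hc.1.le
    rw [show (n:ℝ) - (n + 1) = -1 by ring] at h1
    linarith
  have hne : (Γcan Q).Nonempty := ⟨0, zero_mem Q⟩
  have hbd : BddAbove (Γcan Q) := ⟨K, hK⟩
  refine ⟨sSup (Γcan Q), ?_, fun β hβ => le_csSup hbd hβ⟩
  obtain ⟨u, -, hu, hum⟩ := exists_seq_tendsto_sSup hne hbd
  have hB0 : 0 ≤ sSup (Γcan Q) := le_csSup hbd (zero_mem Q)
  set v : ℕ → ℝ := fun k => max (u k) 0
  have hv : Tendsto v atTop (𝓝 (sSup (Γcan Q))) := by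
    have := hu.max (tendsto_const_nhds (x := (0:ℝ)))
    rwa [max_eq_left hB0] at this
  have hvm : ∀ k, v k ∈ Γcan Q := by
    intro k
    rcases max_choice (u k) 0 with h | h
    · simp only [v, h]; exact hum k
    · simp only [v, h]; exact zero_mem Q
  have hZ : ∀ k, Z Q (v k) ≤ ENNReal.ofReal (2 * Real.exp (K * n)) := by
    intro k
    have h0 : 0 ≤ v k := le_max_right _ _
    refine (Z_upper Q (hvm k) measurableSet_Ici (hn _ (hvm k)) n (hcc _ h0)).trans ?_
    gcongr
    exact hK (hvm k)
  show Z Q _ < ⊤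
  calc Z Q (sSup (Γcan Q))
      = ∫⁻ x, liminf (fun k => ENNReal.ofReal (Real.exp (v k * x))) atTop ∂Q := by
        rw [Z]
        congr 1
        ext x
        symm
        apply Tendsto.liminf_eq
        apply (ENNReal.continuous_ofReal.tendsto _).comp
        apply (Real.continuous_exp.tendsto _).comp
        exact hv.mul_const x
    _ ≤ liminf (fun k => ∫⁻ x, ENNReal.ofReal (Real.exp (v k * x)) ∂Q) atTop :=
        lintegral_liminf_le (fun k => by fun_prop)
    _ ≤ liminf (fun k => ENNReal.ofReal (2 * Real.exp (K * n))) (atTop : Filter ℕ) :=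
        liminf_le_liminf (Eventually.of_forall hZ)
    _ = ENNReal.ofReal (2 * Real.exp (K * n)) := by simp
    _ < ⊤ := ENNReal.ofReal_lt_top

lemma backward (Q : Measure ℝ) [IsProbabilityMeasure Q] (hlt : LeftTruncated Q)
    (h : ∃ Qdom : Measure ℝ, IsProbabilityMeasure Qdom ∧
        (⨆ β ∈ Γcan Q, KL (Pexp Q β) Qdom) < ⊤) : Shtarkov Q < ⊤ := by
  obtain ⟨a₀, ha₀⟩ := hlt
  have hne : Q.support.Nonempty := Measure.nonempty_support (IsProbabilityMeasure.ne_zero Q)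
  have hsub : Q.support ⊆ Ici a₀ := Measure.support_subset_of_isClosed isClosed_Ici ha₀
  have hbb : BddBelow Q.support := ⟨a₀, fun x hx => hsub hx⟩
  have hclosed : IsClosed Q.support := Measure.isClosed_support
  have hae : ∀ᵐ x ∂Q, x ∈ Q.support := Measure.support_mem_ae
  set a := sInf Q.support
  have hamem : a ∈ Q.support := hclosed.csInf_mem hne hbb
  have hale : ∀ᵐ x ∂Q, a ≤ x := by
    filter_upwards [hae] with x hx using csInf_le hbb hx
  have hQa : Q {a} ≠ 0 := by
    refine end_atom Q h (-1) (by norm_num) a ?_ hamem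
    filter_upwards [hale] with x hx
    linarith
  by_cases hbd : BddAbove Q.support
  · set b := sSup Q.support
    have hbmem : b ∈ Q.support := hclosed.csSup_mem hne hbd
    have hble : ∀ᵐ x ∂Q, x ≤ b := by
      filter_upwards [hae] with x hx using le_csSup hbd hx
    have hQb : Q {b} ≠ 0 := by
      refine end_atom Q h 1 (by norm_num) b ?_ hbmem
      filter_upwards [hble] with x hx
      linarith
    calc Shtarkov Q ≤ ∫⁻ x, (Q {a})⁻¹ + (Q {b})⁻¹ ∂Q := by
          apply lintegral_mono_ae
          filter_upwards [hale, hble] with x hxa hxb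
          refine iSup₂_le fun β hβ => ?_
          rcases le_total β 0 with h0 | h0
          · exact (dens_atom Q β a x (mul_le_mul_of_nonpos_left hxa h0) hQa).trans le_self_add
          · exact (dens_atom Q β b x (mul_le_mul_of_nonneg_left hxb h0) hQb).trans le_add_self
      _ < ⊤ := by simp [hQa, hQb, pos_iff_ne_zero]
  · obtain ⟨B, hB, hBmax⟩ := unbdd_max Q h hbd
    calc Shtarkov Q ≤ ∫⁻ x, (Q {a})⁻¹ +
            ENNReal.ofReal (Real.exp (-(B * a))) * (Q {a})⁻¹ * ENNReal.ofReal (Real.exp (B * x)) ∂Q := by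
          apply lintegral_mono_ae
          filter_upwards [hale] with x hxa
          refine iSup₂_le fun β hβ => ?_
          rcases le_total β 0 with h0 | h0
          · exact (dens_atom Q β a x (mul_le_mul_of_nonpos_left hxa h0) hQa).trans le_self_add
          · refine le_trans ?_ le_add_self
            have h1 := dens_atom Q β a a le_rfl hQa
            have h2 : ENNReal.ofReal (Real.exp (β * x)) =
                ENNReal.ofReal (Real.exp (β * (x - a))) * ENNReal.ofReal (Real.exp (β * a)) := by
              rw [← ENNReal.ofReal_mul (by positivity), ← Real.exp_add]; ring_nf
            have h3 : ENNReal.ofReal (Real.exp (β * (x - a))) ≤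
                ENNReal.ofReal (Real.exp (-(B * a))) * ENNReal.ofReal (Real.exp (B * x)) := by
              rw [← ENNReal.ofReal_mul (by positivity), ← Real.exp_add]
              gcongr
              have := mul_le_mul_of_nonneg_right (hBmax β hβ) (sub_nonneg.2 hxa)
              linarith
            rw [h2, mul_div_assoc, mul_right_comm]
            gcongr
      _ = (Q {a})⁻¹ + ENNReal.ofReal (Real.exp (-(B * a))) * (Q {a})⁻¹ * Z Q B := by
          rw [lintegral_add_left measurable_const, lintegral_const_mul _ (by fun_prop)]
          simp [Z]
      _ < ⊤ := by
          have h1 : Z Q B < ⊤ := hB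
          have h2 : (Q {a})⁻¹ < ⊤ := by simp [hQa, pos_iff_ne_zero]
          exact ENNReal.add_lt_top.2 ⟨h2, ENNReal.mul_lt_top (ENNReal.mul_lt_top (by simp) h2) h1⟩

/-- for a left-truncated family, the Shtarkov integral is finite iff
there is a dominating distribution in the sense of information divergence. -/
theorem shtarkov_finite_iff_dominating (Q : Measure ℝ) [IsProbabilityMeasure Q]
    (hlt : LeftTruncated Q) :
    Shtarkov Q < ⊤ ↔
      ∃ Qdom : Measure ℝ, IsProbabilityMeasure Qdom ∧
        (⨆ β ∈ Γcan Q, KL (Pexp Q β) Qdom) < ⊤ := by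
  exact ⟨forward Q, backward Q hlt⟩
end
end

section
/- For a one-dimensional left-truncated exponential family, the minimax expected redundancy inf_Q' sup_{β ∈ Γ} D(P_β ‖ Q') is finite if and only if the information channel β ↦ P_β has finite capacity sup over priors π on Γ of the mutual information I(π). -/
open scoped ENNReal NNReal
open MeasureTheory Real Set Filter Topology Asymptotics ProbabilityTheory

noncomputable section

set_option linter.unusedSectionVars false

/-- density of `Pexp Q β` as a real function -/
def pd (Q : Measure ℝ) (β x : ℝ) : ℝ := Real.exp (β * x) / (Z Q β).toReal

def GG (a b : ℝ) : ℝ := a * Real.log (a / b) + b - a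

def pbar (Q ρ : Measure ℝ) (x : ℝ) : ℝ := (∫⁻ β, ENNReal.ofReal (pd Q β x) ∂ρ).toReal

def Prior (Q ρ : Measure ℝ) : Prop := IsProbabilityMeasure ρ ∧ ρ (Γcan Q) = 1

def IG (Q ρ : Measure ℝ) : ℝ≥0∞ :=
  ∫⁻ β, ∫⁻ x, ENNReal.ofReal (GG (pd Q β x) (pbar Q ρ x)) ∂Q ∂ρ

lemma GG_nonneg {a b : ℝ} (ha : 0 ≤ a) (hb : 0 < b) : 0 ≤ GG a b := by
  unfold GG
  rcases ha.eq_or_lt with h | h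
  · subst h; simp; exact hb.le
  · have := Real.one_sub_inv_le_log_of_pos (div_pos h hb)
    have h2 : a * (1 - (a / b)⁻¹) = a - b := by field_simp
    nlinarith [mul_le_mul_of_nonneg_left this h.le]

lemma GG_sub {f m q : ℝ} (hf : 0 ≤ f) (hm : 0 < m) (hq : 0 < q) :
    GG f q = GG f m + (f * Real.log (m / q) + (q - m)) := by
  unfold GG
  rcases hf.eq_or_lt with h | h
  · subst h; simp
  · rw [Real.log_div h.ne' hq.ne', Real.log_div h.ne' hm.ne', Real.log_div hm.ne' hq.ne']; ring

lemma GG_half {a b : ℝ} (ha : 0 < a) (hb : 0 < b) :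
    (√a - √b) ^ 2 ≤ 2 * (GG a ((1 - 1/2) * a + 1/2 * b) + GG b ((1 - 1/2) * a + 1/2 * b)) := by
  have key : ∀ c m : ℝ, 0 < c → 0 < m → 2 * c - 2 * √c * √m ≤ c * Real.log (c / m) := by
    intro c m hc hm
    have hc' := Real.sqrt_pos.2 hc
    have hm' := Real.sqrt_pos.2 hm
    have h1 := Real.one_sub_inv_le_log_of_pos (div_pos hc' hm')
    have h2 : Real.log (c / m) = 2 * Real.log (√c / √m) := by
      rw [← Real.sqrt_div hc.le, Real.log_sqrt (by positivity)]; ring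
    have h3 : c * (2 * (1 - (√c / √m)⁻¹)) = 2 * c - 2 * √c * √m := by
      have : c = √c * √c := (Real.mul_self_sqrt hc.le).symm
      rw [inv_div]
      field_simp
      nlinarith
    rw [h2, ← h3]
    gcongr
  set m := (1 - 1/2) * a + 1/2 * b with hm
  have hm0 : 0 < m := by rw [hm]; linarith
  have k1 := key a m ha hm0
  have k2 := key b m hb hm0
  unfold GG
  have ea := Real.sq_sqrt ha.le
  have eb := Real.sq_sqrt hb.le
  have em := Real.sq_sqrt hm0.le
  have pa := Real.sqrt_pos.2 ha
  have pb := Real.sqrt_pos.2 hb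
  have pm := Real.sqrt_pos.2 hm0
  set A := √a
  set B := √b
  set M := √m
  have e : 2 * M ^ 2 = A ^ 2 + B ^ 2 := by rw [em, ea, eb, hm]; ring
  have hs : A + B ≤ 2 * M := by
    nlinarith [sq_nonneg (A - B)]
  have hX : (A - B) ^ 2 = (2 * M - (A + B)) * (2 * M + (A + B)) := by nlinarith
  have : (2 * M - (A + B)) * (2 * M + (A + B)) ≤ (2 * M - (A + B)) * (4 * M) := by
    apply mul_le_mul_of_nonneg_left <;> linarith
  nlinarith

section meas
variable (Q : Measure ℝ) [IsProbabilityMeasure Q]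

lemma measurable_Z : Measurable (Z Q) := by
  unfold Z
  apply Measurable.lintegral_prod_right'
    (f := fun z : ℝ × ℝ => ENNReal.ofReal (Real.exp (z.1 * z.2)))
  fun_prop

lemma measurable_pd : Measurable (fun z : ℝ × ℝ => pd Q z.1 z.2) := by
  unfold pd
  have h : Measurable (fun z : ℝ × ℝ => (Z Q z.1).toReal) :=
    (measurable_Z Q).ennreal_toReal.comp measurable_fst
  exact Measurable.div (by fun_prop) h

lemma measurableSet_Γ : MeasurableSet (Γcan Q) := by
  exact measurableSet_lt (measurable_Z Q) measurable_const

lemma Z_pos (β : ℝ) : 0 < Z Q β := by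
  unfold Z
  rw [lintegral_pos_iff_support (by fun_prop)]
  have : (Function.support fun x => ENNReal.ofReal (Real.exp (β * x))) = univ := by
    ext x; simp [Real.exp_pos]
  rw [this]; simp

lemma pd_nonneg (β x : ℝ) : 0 ≤ pd Q β x := by unfold pd; positivity

lemma pd_pos {β : ℝ} (hβ : β ∈ Γcan Q) (x : ℝ) : 0 < pd Q β x := by
  unfold pd
  have := ENNReal.toReal_pos (Z_pos Q β).ne' (ne_of_lt hβ)
  positivity

lemma Pexp_eq (β : ℝ) : Pexp Q β = Q.withDensity (fun x => ENNReal.ofReal (pd Q β x)) := by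
  unfold Pexp pd
  congr 1
  ext x
  by_cases h : Z Q β = ⊤
  · simp [h]
  · rw [ENNReal.ofReal_div_of_pos (ENNReal.toReal_pos (Z_pos Q β).ne' h), ENNReal.ofReal_toReal h]

lemma lintegral_pd {β : ℝ} (hβ : β ∈ Γcan Q) : ∫⁻ x, ENNReal.ofReal (pd Q β x) ∂Q = 1 := by
  have h : ∀ x, ENNReal.ofReal (pd Q β x) = ENNReal.ofReal (Real.exp (β * x)) * (Z Q β)⁻¹ := by
    intro x
    unfold pd
    rw [ENNReal.ofReal_div_of_pos (ENNReal.toReal_pos (Z_pos Q β).ne' (ne_of_lt hβ)),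
      ENNReal.ofReal_toReal (ne_of_lt hβ)]; rfl
  simp_rw [h]
  rw [lintegral_mul_const _ (by fun_prop)]
  exact ENNReal.mul_inv_cancel (Z_pos Q β).ne' (ne_of_lt hβ)

lemma measurable_pd_right (β : ℝ) : Measurable (fun x => pd Q β x) := 
  (measurable_pd Q).comp (by fun_prop : Measurable fun x : ℝ => (β, x))

lemma measurable_pd_left (x : ℝ) : Measurable (fun β => pd Q β x) := 
  (measurable_pd Q).comp (by fun_prop : Measurable fun β : ℝ => (β, x))

lemma measurable_pbarE (ρ : Measure ℝ) [SFinite ρ] :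
    Measurable (fun x => ∫⁻ β, ENNReal.ofReal (pd Q β x) ∂ρ) :=
  Measurable.lintegral_prod_left' (f := fun z : ℝ × ℝ => ENNReal.ofReal (pd Q z.1 z.2))
    (measurable_pd Q).ennreal_ofReal

lemma measurable_pbar (ρ : Measure ℝ) [SFinite ρ] : Measurable (pbar Q ρ) :=
  (measurable_pbarE Q ρ).ennreal_toReal

lemma measurable_GG {α : Type*} [MeasurableSpace α] {f g : α → ℝ} (hf : Measurable f)
    (hg : Measurable g) : Measurable (fun x => GG (f x) (g x)) := by
  unfold GG; fun_prop

lemma prior_ae {ρ : Measure ℝ} (h : Prior Q ρ) : ∀ᵐ β ∂ρ, β ∈ Γcan Q := by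
  have := h.1
  exact (prob_compl_eq_zero_iff (measurableSet_Γ Q)).2 h.2

lemma lintegral_pbarE {ρ : Measure ℝ} (h : Prior Q ρ) :
    ∫⁻ x, ∫⁻ β, ENNReal.ofReal (pd Q β x) ∂ρ ∂Q = 1 := by
  have := h.1
  rw [lintegral_lintegral_swap]
  · rw [lintegral_congr_ae (g := fun _ => 1)]
    · simp
    · filter_upwards [prior_ae Q h] with β hβ using lintegral_pd Q hβ
  · exact ((measurable_pd Q).ennreal_ofReal.comp measurable_swap).aemeasurable

lemma pbar_ae {ρ : Measure ℝ} (h : Prior Q ρ) :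
    ∀ᵐ x ∂Q, 0 < pbar Q ρ x ∧
      (∫⁻ β, ENNReal.ofReal (pd Q β x) ∂ρ) = ENNReal.ofReal (pbar Q ρ x) := by
  have := h.1
  have hlt : ∀ᵐ x ∂Q, (∫⁻ β, ENNReal.ofReal (pd Q β x) ∂ρ) < ⊤ :=
    ae_lt_top (measurable_pbarE Q ρ) (by rw [lintegral_pbarE Q h]; simp)
  filter_upwards [hlt] with x hx
  have hpos : (∫⁻ β, ENNReal.ofReal (pd Q β x) ∂ρ) ≠ 0 := by
    intro h0
    rw [lintegral_eq_zero_iff (measurable_pd_left Q x).ennreal_ofReal] at h0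
    have : ∀ᵐ β ∂ρ, False := by
      filter_upwards [h0, prior_ae Q h] with β h1 h2
      have := pd_pos Q h2 x
      simp at h1
      linarith
    simp at this
    exact (IsProbabilityMeasure.ne_zero ρ) this
  exact ⟨ENNReal.toReal_pos hpos hx.ne, (ENNReal.ofReal_toReal hx.ne).symm⟩

lemma lintegral_pbar {ρ : Measure ℝ} (h : Prior Q ρ) :
    ∫⁻ x, ENNReal.ofReal (pbar Q ρ x) ∂Q = 1 := by
  rw [← lintegral_pbarE Q h]
  apply lintegral_congr_ae
  filter_upwards [pbar_ae Q h] with x hx using hx.2.symm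

lemma comp_point {ρ : Measure ℝ} [IsProbabilityMeasure ρ] {f : ℝ → ℝ} (hf : Measurable f)
    (hf0 : ∀ x, 0 ≤ f x) {m q : ℝ} (hm : 0 < m) (hq : 0 < q)
    (hfm : ∫⁻ β, ENNReal.ofReal (f β) ∂ρ = ENNReal.ofReal m) :
    ∫⁻ β, ENNReal.ofReal (GG (f β) q) ∂ρ =
      ∫⁻ β, ENNReal.ofReal (GG (f β) m) ∂ρ + ENNReal.ofReal (GG m q) := by
  have hfi : Integrable f ρ := by
    refine ⟨hf.aestronglyMeasurable, ?_⟩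
    rw [hasFiniteIntegral_iff_ofReal (ae_of_all _ hf0), hfm]
    exact ENNReal.ofReal_lt_top
  have hfint : ∫ β, f β ∂ρ = m := by
    rw [integral_eq_lintegral_of_nonneg_ae (ae_of_all _ hf0) hf.aestronglyMeasurable, hfm,
      ENNReal.toReal_ofReal hm.le]
  have hh : Integrable (fun β => f β * Real.log (m / q) + (q - m)) ρ :=
    (hfi.mul_const _).add (integrable_const _)
  have hhint : ∫ β, (f β * Real.log (m / q) + (q - m)) ∂ρ = GG m q := by
    rw [integral_add (hfi.mul_const _) (integrable_const _), integral_mul_const, hfint]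
    simp [GG]; ring
  have e : ∀ β, GG (f β) q = GG (f β) m + (f β * Real.log (m / q) + (q - m)) :=
    fun β => GG_sub (hf0 β) hm hq
  have mq : Measurable (fun β => GG (f β) q) := measurable_GG hf measurable_const
  have mm : Measurable (fun β => GG (f β) m) := measurable_GG hf measurable_const
  have n1 : ∀ β, 0 ≤ GG (f β) q := fun β => GG_nonneg (hf0 β) hq
  have n2 : ∀ β, 0 ≤ GG (f β) m := fun β => GG_nonneg (hf0 β) hm
  by_cases hi : Integrable (fun β => GG (f β) m) ρ
  · have hi2 : Integrable (fun β => GG (f β) q) ρ := by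
      simp_rw [e]; exact hi.add hh
    rw [← ofReal_integral_eq_lintegral_ofReal hi (ae_of_all _ n2),
      ← ofReal_integral_eq_lintegral_ofReal hi2 (ae_of_all _ n1),
      ← ENNReal.ofReal_add (integral_nonneg n2) (GG_nonneg hm.le hq)]
    congr 1
    rw [← hhint, ← integral_add hi hh]
    exact integral_congr_ae (ae_of_all _ e)
  · have hi2 : ¬ Integrable (fun β => GG (f β) q) ρ := by
      intro h2
      apply hi
      have : (fun β => GG (f β) m) = fun β => GG (f β) q - (f β * Real.log (m / q) + (q - m)) := by
        ext β; rw [e]; ring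
      rw [this]
      exact h2.sub hh
    have t : ∀ g : ℝ → ℝ, Measurable g → (∀ β, 0 ≤ g β) → ¬ Integrable g ρ →
        ∫⁻ β, ENNReal.ofReal (g β) ∂ρ = ⊤ := by
      intro g hg hg0 hgi
      by_contra hne
      apply hgi
      refine ⟨hg.aestronglyMeasurable, ?_⟩
      rw [hasFiniteIntegral_iff_ofReal (ae_of_all _ hg0)]
      exact lt_top_iff_ne_top.2 hne
    rw [t _ mq n1 hi2, t _ mm n2 hi]; simp

lemma comp_id {ρ : Measure ℝ} (h : Prior Q ρ) {q : ℝ → ℝ} (hq : Measurable q)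
    (hq0 : ∀ᵐ x ∂Q, 0 < q x) :
    ∫⁻ β, ∫⁻ x, ENNReal.ofReal (GG (pd Q β x) (q x)) ∂Q ∂ρ =
      IG Q ρ + ∫⁻ x, ENNReal.ofReal (GG (pbar Q ρ x) (q x)) ∂Q := by
  have := h.1
  unfold IG
  have mb := measurable_pbar Q ρ
  rw [lintegral_lintegral_swap
    (measurable_GG (measurable_pd Q) (hq.comp measurable_snd)).ennreal_ofReal.aemeasurable]
  rw [lintegral_lintegral_swap (μ := ρ) (f := fun β x => ENNReal.ofReal (GG (pd Q β x) (pbar Q ρ x)))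
    (measurable_GG (measurable_pd Q) (mb.comp measurable_snd)).ennreal_ofReal.aemeasurable]
  rw [← lintegral_add_right _ (measurable_GG mb hq).ennreal_ofReal]
  apply lintegral_congr_ae
  filter_upwards [hq0, pbar_ae Q h] with x h1 h2
  exact comp_point (measurable_pd_left Q x) (fun β => pd_nonneg Q β x) h2.1 h1 h2.2

def mixp (t : ℝ) (ρ₁ ρ₂ : Measure ℝ) : Measure ℝ :=
  ENNReal.ofReal (1 - t) • ρ₁ + ENNReal.ofReal t • ρ₂

lemma mix_prior {t : ℝ} (ht : 0 < t) (ht1 : t < 1) {ρ₁ ρ₂ : Measure ℝ} (h1 : Prior Q ρ₁)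
    (h2 : Prior Q ρ₂) : Prior Q (mixp t ρ₁ ρ₂) := by
  have := h1.1
  have := h2.1
  have e : ENNReal.ofReal (1 - t) + ENNReal.ofReal t = 1 := by
    rw [← ENNReal.ofReal_add (by linarith) ht.le]; simp
  refine ⟨⟨?_⟩, ?_⟩ 
  · simp [mixp, e]
  · simp [mixp, h1.2, h2.2, e]

lemma mix_pbar {t : ℝ} (ht : 0 < t) (ht1 : t < 1) {ρ₁ ρ₂ : Measure ℝ} (h1 : Prior Q ρ₁)
    (h2 : Prior Q ρ₂) : ∀ᵐ x ∂Q,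
      pbar Q (mixp t ρ₁ ρ₂) x = (1 - t) * pbar Q ρ₁ x + t * pbar Q ρ₂ x := by
  filter_upwards [pbar_ae Q h1, pbar_ae Q h2] with x a b
  have : pbar Q (mixp t ρ₁ ρ₂) x = (∫⁻ β, ENNReal.ofReal (pd Q β x) ∂(mixp t ρ₁ ρ₂)).toReal := rfl
  rw [this, mixp, lintegral_add_measure, lintegral_smul_measure, lintegral_smul_measure, a.2, b.2]
  have h1t : 0 ≤ 1 - t := by linarith
  simp only [smul_eq_mul]
  rw [← ENNReal.ofReal_mul h1t, ← ENNReal.ofReal_mul ht.le,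
    ← ENNReal.ofReal_add (mul_nonneg h1t a.1.le) (mul_nonneg ht.le b.1.le), ENNReal.toReal_ofReal]
  exact add_nonneg (mul_nonneg h1t a.1.le) (mul_nonneg ht.le b.1.le)

lemma mix_IG {t : ℝ} (ht : 0 < t) (ht1 : t < 1) {ρ₁ ρ₂ : Measure ℝ} (h1 : Prior Q ρ₁)
    (h2 : Prior Q ρ₂) : IG Q (mixp t ρ₁ ρ₂) =
      ENNReal.ofReal (1 - t) * (IG Q ρ₁ + ∫⁻ x, ENNReal.ofReal
        (GG (pbar Q ρ₁ x) ((1 - t) * pbar Q ρ₁ x + t * pbar Q ρ₂ x)) ∂Q) +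
      ENNReal.ofReal t * (IG Q ρ₂ + ∫⁻ x, ENNReal.ofReal
        (GG (pbar Q ρ₂ x) ((1 - t) * pbar Q ρ₁ x + t * pbar Q ρ₂ x)) ∂Q) := by
  have hp := mix_prior Q ht ht1 h1 h2
  have := h1.1
  have := h2.1
  have m1 := measurable_pbar Q ρ₁
  have m2 := measurable_pbar Q ρ₂
  have hpos : ∀ᵐ x ∂Q, 0 < (1 - t) * pbar Q ρ₁ x + t * pbar Q ρ₂ x := by
    filter_upwards [pbar_ae Q h1, pbar_ae Q h2] with x a b
    have := a.1
    have := b.1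
    have : 0 < 1 - t := by linarith
    positivity
  have hm : Measurable fun x => (1 - t) * pbar Q ρ₁ x + t * pbar Q ρ₂ x := by fun_prop
  rw [← comp_id Q h1 hm hpos, ← comp_id Q h2 hm hpos]
  have : IG Q (mixp t ρ₁ ρ₂) = ∫⁻ β, ∫⁻ x, ENNReal.ofReal (GG (pd Q β x)
      ((1 - t) * pbar Q ρ₁ x + t * pbar Q ρ₂ x)) ∂Q ∂(mixp t ρ₁ ρ₂) := by
    unfold IG
    apply lintegral_congr
    intro β
    apply lintegral_congr_ae
    filter_upwards [mix_pbar Q ht ht1 h1 h2] with x hx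
    rw [hx]
  rw [this, mixp, lintegral_add_measure, lintegral_smul_measure, lintegral_smul_measure]
  rfl

lemma dirac_prior {β : ℝ} (hβ : β ∈ Γcan Q) : Prior Q (Measure.dirac β) := by
  refine ⟨inferInstance, ?_⟩
  rw [Measure.dirac_apply' _ (measurableSet_Γ Q)]
  simp [hβ]

lemma dirac_pbar (β x : ℝ) : pbar Q (Measure.dirac β) x = pd Q β x := by
  unfold pbar
  rw [lintegral_dirac' _ (measurable_pd_left Q x).ennreal_ofReal,
    ENNReal.toReal_ofReal (pd_nonneg Q β x)]

end meas

section two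
variable (Q : Measure ℝ) [IsProbabilityMeasure Q]

lemma Pexp_ac (β : ℝ) : Pexp Q β ≪ Q := withDensity_absolutelyContinuous _ _

lemma log_rnDeriv {m : Measure ℝ} [IsProbabilityMeasure m] {q : ℝ → ℝ} (β : ℝ)
    (hQm : Q ≪ m) (hq0 : ∀ᵐ x ∂Q, 0 < q x) (hq : ∀ᵐ x ∂Q, m.rnDeriv Q x = ENNReal.ofReal (q x)) :
    ∀ᵐ x ∂Q, Real.log ((Pexp Q β).rnDeriv m x).toReal = Real.log (pd Q β x / q x) := by
  rw [Pexp_eq]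
  have h1 := hQm (Measure.rnDeriv_withDensity_left_of_absolutelyContinuous hQm
    (f := fun x => ENNReal.ofReal (pd Q β x)) (measurable_pd_right Q β).ennreal_ofReal.aemeasurable)
  have h2 := Measure.inv_rnDeriv' hQm
  filter_upwards [h1, h2, hq0, hq] with x a b c d
  rw [a, ← b]
  simp only [Pi.inv_apply]
  rw [d, ENNReal.toReal_mul, ENNReal.toReal_inv, ENNReal.toReal_ofReal c.le,
    ENNReal.toReal_ofReal (pd_nonneg Q β x)]
  rfl

lemma KL_eq {m : Measure ℝ} [IsProbabilityMeasure m] {q : ℝ → ℝ} (β : ℝ)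
    (hQm : Q ≪ m) (hq0 : ∀ᵐ x ∂Q, 0 < q x) (hq : ∀ᵐ x ∂Q, m.rnDeriv Q x = ENNReal.ofReal (q x)) :
    (Integrable (fun x => Real.log ((Pexp Q β).rnDeriv m x).toReal) (Pexp Q β) ↔
      Integrable (fun x => pd Q β x * Real.log (pd Q β x / q x)) Q) ∧
    ∫ x, Real.log ((Pexp Q β).rnDeriv m x).toReal ∂(Pexp Q β) =
      ∫ x, pd Q β x * Real.log (pd Q β x / q x) ∂Q := by
  have h := log_rnDeriv Q β hQm hq0 hq
  have h' := (Pexp_ac Q β).ae_le h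
  have mp := (measurable_pd_right Q β).ennreal_ofReal
  rw [integrable_congr h', integral_congr_ae h', Pexp_eq,
    integrable_withDensity_iff_integrable_smul' mp (by simp),
    integral_withDensity_eq_integral_toReal_smul mp (by simp)]
  simp [ENNReal.toReal_ofReal (pd_nonneg Q β _)]

lemma pd_integrable {β : ℝ} (hβ : β ∈ Γcan Q) : Integrable (fun x => pd Q β x) Q ∧
    ∫ x, pd Q β x ∂Q = 1 := by
  refine ⟨⟨(measurable_pd_right Q β).aestronglyMeasurable, ?_⟩, ?_⟩
  · rw [hasFiniteIntegral_iff_ofReal (ae_of_all _ (pd_nonneg Q β)), lintegral_pd Q hβ]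
    simp
  · rw [integral_eq_lintegral_of_nonneg_ae (ae_of_all _ (pd_nonneg Q β))
      (measurable_pd_right Q β).aestronglyMeasurable, lintegral_pd Q hβ]
    simp

lemma q_integrable {m : Measure ℝ} [IsProbabilityMeasure m] {q : ℝ → ℝ} (hqm : Measurable q)
    (hq0 : ∀ᵐ x ∂Q, 0 < q x) (hq : ∀ᵐ x ∂Q, m.rnDeriv Q x = ENNReal.ofReal (q x)) :
    Integrable q Q ∧ ∫ x, q x ∂Q ≤ 1 ∧ (m ≪ Q → ∫ x, q x ∂Q = 1) := by
  have hn : 0 ≤ᵐ[Q] q := by filter_upwards [hq0] with x hx using hx.le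
  have e : ∫⁻ x, ENNReal.ofReal (q x) ∂Q = ∫⁻ x, m.rnDeriv Q x ∂Q := by
    apply lintegral_congr_ae
    filter_upwards [hq] with x hx using hx.symm
  have hle : ∫⁻ x, ENNReal.ofReal (q x) ∂Q ≤ 1 := by
    rw [e]; exact Measure.lintegral_rnDeriv_le.trans (by simp)
  refine ⟨⟨hqm.aestronglyMeasurable, ?_⟩, ?_, ?_⟩
  · rw [hasFiniteIntegral_iff_ofReal hn]
    exact hle.trans_lt (by simp)
  · rw [integral_eq_lintegral_of_nonneg_ae hn hqm.aestronglyMeasurable]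
    exact ENNReal.toReal_le_of_le_ofReal zero_le_one (by simpa using hle)
  · intro hm
    rw [integral_eq_lintegral_of_nonneg_ae hn hqm.aestronglyMeasurable, e,
      Measure.lintegral_rnDeriv hm]
    simp

lemma G_le_KL {m : Measure ℝ} [IsProbabilityMeasure m] {q : ℝ → ℝ} {β : ℝ} (hβ : β ∈ Γcan Q)
    (hQm : Q ≪ m) (hqm : Measurable q)
    (hq0 : ∀ᵐ x ∂Q, 0 < q x) (hq : ∀ᵐ x ∂Q, m.rnDeriv Q x = ENNReal.ofReal (q x)) :
    ∫⁻ x, ENNReal.ofReal (GG (pd Q β x) (q x)) ∂Q ≤ KL (Pexp Q β) m := by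
  obtain ⟨k1, k2⟩ := KL_eq Q β hQm hq0 hq
  obtain ⟨i1, i2⟩ := pd_integrable Q hβ
  obtain ⟨j1, j2, -⟩ := q_integrable Q hqm hq0 hq
  unfold KL
  split_ifs with h
  · have h2 := k1.1 h.2
    rw [k2]
    have hi : Integrable (fun x => GG (pd Q β x) (q x)) Q := (h2.add j1).sub i1
    rw [← ofReal_integral_eq_lintegral_ofReal hi]
    · apply ENNReal.ofReal_le_ofReal
      unfold GG
      rw [integral_sub (f := fun x => pd Q β x * Real.log (pd Q β x / q x) + q x) (h2.add j1) i1,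
        integral_add h2 j1]
      linarith
    · filter_upwards [hq0] with x hx using GG_nonneg (pd_nonneg Q β x) hx
  · exact le_top

lemma KL_le_G {m : Measure ℝ} [IsProbabilityMeasure m] {q : ℝ → ℝ} {β : ℝ} (hβ : β ∈ Γcan Q)
    (hQm : Q ≪ m) (hmQ : m ≪ Q) (hqm : Measurable q)
    (hq0 : ∀ᵐ x ∂Q, 0 < q x) (hq : ∀ᵐ x ∂Q, m.rnDeriv Q x = ENNReal.ofReal (q x)) :
    KL (Pexp Q β) m ≤ ∫⁻ x, ENNReal.ofReal (GG (pd Q β x) (q x)) ∂Q := by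
  obtain ⟨k1, k2⟩ := KL_eq Q β hQm hq0 hq
  obtain ⟨i1, i2⟩ := pd_integrable Q hβ
  obtain ⟨j1, -, j2⟩ := q_integrable Q hqm hq0 hq
  have j3 := j2 hmQ
  have hn : 0 ≤ᵐ[Q] (fun x => GG (pd Q β x) (q x)) := by
    filter_upwards [hq0] with x hx using GG_nonneg (pd_nonneg Q β x) hx
  by_cases hT : ∫⁻ x, ENNReal.ofReal (GG (pd Q β x) (q x)) ∂Q = ⊤
  · rw [hT]; exact le_top
  have hi : Integrable (fun x => GG (pd Q β x) (q x)) Q := by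
    refine ⟨(measurable_GG (measurable_pd_right Q β) hqm).aestronglyMeasurable, ?_⟩
    rw [hasFiniteIntegral_iff_ofReal hn]
    exact lt_top_iff_ne_top.2 hT
  have h2 : Integrable (fun x => pd Q β x * Real.log (pd Q β x / q x)) Q := by
    have := (hi.sub j1).add i1
    refine this.congr (ae_of_all _ fun x => ?_)
    simp [GG]
    ring
  have hc : Pexp Q β ≪ m ∧
      Integrable (fun x => Real.log ((Pexp Q β).rnDeriv m x).toReal) (Pexp Q β) :=
    ⟨(Pexp_ac Q β).trans hQm, k1.2 h2⟩
  unfold KL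
  rw [if_pos hc, k2, ← ofReal_integral_eq_lintegral_ofReal hi hn]
  apply ENNReal.ofReal_le_ofReal
  unfold GG
  rw [integral_sub (f := fun x => pd Q β x * Real.log (pd Q β x / q x) + q x) (h2.add j1) i1,
        integral_add h2 j1]
  linarith

lemma zero_mem_Γ : (0 : ℝ) ∈ Γcan Q := by simp [Γcan, Z]

lemma Pexp_zero : Pexp Q 0 = Q := by simp [Pexp, Z]

lemma measurable_Pexp : Measurable (Pexp Q) := by
  apply Measure.measurable_of_measurable_coe
  intro s hs
  simp_rw [Pexp_eq, withDensity_apply _ hs]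
  exact Measurable.lintegral_prod_right' (f := fun z : ℝ × ℝ => ENNReal.ofReal (pd Q z.1 z.2))
    (measurable_pd Q).ennreal_ofReal

lemma bind_eq {ρ : Measure ℝ} (h : Prior Q ρ) :
    ρ.bind (Pexp Q) = Q.withDensity (fun x => ∫⁻ β, ENNReal.ofReal (pd Q β x) ∂ρ) := by
  have := h.1
  ext s hs
  rw [Measure.bind_apply hs (measurable_Pexp Q).aemeasurable, withDensity_apply _ hs]
  simp_rw [Pexp_eq, withDensity_apply _ hs]
  rw [lintegral_lintegral_swap]
  exact (measurable_pd Q).ennreal_ofReal.aemeasurable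

lemma ac_withDensity {f : ℝ → ℝ≥0∞} (hf : Measurable f) (h0 : ∀ᵐ x ∂Q, f x ≠ 0) :
    Q ≪ Q.withDensity f := withDensity_absolutelyContinuous' hf.aemeasurable h0

lemma IG_eq {ρ : Measure ℝ} (h : Prior Q ρ) :
    ∫⁻ β, KL (Pexp Q β) (ρ.bind (Pexp Q)) ∂ρ = IG Q ρ := by
  have := h.1
  have hm := measurable_pbarE Q ρ
  have hb := pbar_ae Q h
  have hprob : IsProbabilityMeasure (ρ.bind (Pexp Q)) := by
    constructor
    rw [bind_eq Q h, withDensity_apply _ MeasurableSet.univ]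
    simpa using lintegral_pbarE Q h
  have hQm : Q ≪ ρ.bind (Pexp Q) := by
    rw [bind_eq Q h]
    apply ac_withDensity Q hm
    filter_upwards [hb] with x hx
    rw [hx.2]
    simpa using hx.1
  have hmQ : ρ.bind (Pexp Q) ≪ Q := by
    rw [bind_eq Q h]; exact withDensity_absolutelyContinuous _ _
  have hq0 : ∀ᵐ x ∂Q, 0 < pbar Q ρ x := by filter_upwards [hb] with x hx using hx.1
  have hq : ∀ᵐ x ∂Q, (ρ.bind (Pexp Q)).rnDeriv Q x = ENNReal.ofReal (pbar Q ρ x) := by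
    rw [bind_eq Q h]
    filter_upwards [Measure.rnDeriv_withDensity Q hm, hb] with x h1 h2
    rw [h1, h2.2]
  unfold IG
  apply lintegral_congr_ae
  filter_upwards [prior_ae Q h] with β hβ
  exact le_antisymm (KL_le_G Q hβ hQm hmQ (measurable_pbar Q ρ) hq0 hq)
    (G_le_KL Q hβ hQm (measurable_pbar Q ρ) hq0 hq)

lemma forward_s8 {m : Measure ℝ} [IsProbabilityMeasure m] {R : ℝ≥0∞} (hR : R < ⊤)
    (hm : ∀ β ∈ Γcan Q, KL (Pexp Q β) m ≤ R) {ρ : Measure ℝ} (h : Prior Q ρ) : IG Q ρ ≤ R := by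
  have := h.1
  have hQm : Q ≪ m := by
    have h0 := hm 0 (zero_mem_Γ Q)
    rw [Pexp_zero] at h0
    by_contra hne
    unfold KL at h0
    rw [if_neg (fun hh => hne hh.1)] at h0
    exact absurd (h0.trans_lt hR) (lt_irrefl _)
  have hlt := Measure.rnDeriv_lt_top m Q
  have hq : ∀ᵐ x ∂Q, m.rnDeriv Q x = ENNReal.ofReal (m.rnDeriv Q x).toReal := by
    filter_upwards [hlt] with x hx
    rw [ENNReal.ofReal_toReal hx.ne]
  have hq0 : ∀ᵐ x ∂Q, 0 < (m.rnDeriv Q x).toReal := by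
    filter_upwards [hlt, Measure.inv_rnDeriv hQm, hQm.ae_le (Measure.rnDeriv_lt_top Q m)]
      with x hx h1 h2
    apply ENNReal.toReal_pos _ hx.ne
    rw [← h1]
    simpa using h2.ne
  have hqm := (Measure.measurable_rnDeriv m Q).ennreal_toReal
  calc IG Q ρ ≤ _ := le_self_add
    _ = _ := (comp_id Q h hqm hq0).symm
    _ ≤ ∫⁻ β, R ∂ρ := by
      apply lintegral_mono_ae
      filter_upwards [prior_ae Q h] with β hβ
      exact (G_le_KL Q hβ hQm hqm hq0 hq).trans (hm β hβ)
    _ = R := by simp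

end two

section three

lemma arith_real {t : ℝ} (ht : 0 < t) (ht1 : t < 1) {S a b X Y : ℝ≥0∞} (hS : S ≠ ⊤)
    (h : ENNReal.ofReal (1 - t) * (a + X) + ENNReal.ofReal t * (b + Y) ≤ S) :
    a ≠ ⊤ ∧ b ≠ ⊤ ∧ X ≠ ⊤ ∧ Y ≠ ⊤ ∧
    (1 - t) * (a.toReal + X.toReal) + t * (b.toReal + Y.toReal) ≤ S.toReal := by
  have h1 : ENNReal.ofReal (1 - t) * (a + X) ≠ ⊤ := ne_top_of_le_ne_top hS (le_self_add.trans h)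
  have h2 : ENNReal.ofReal t * (b + Y) ≠ ⊤ := ne_top_of_le_ne_top hS (le_add_self.trans h)
  have p1 : ENNReal.ofReal (1 - t) ≠ 0 := by simpa using ht1
  have p2 : ENNReal.ofReal t ≠ 0 := by simpa using ht
  have h3 : a + X ≠ ⊤ := fun hh => h1 (by rw [hh, ENNReal.mul_top p1])
  have h4 : b + Y ≠ ⊤ := fun hh => h2 (by rw [hh, ENNReal.mul_top p2])
  rw [ENNReal.add_ne_top] at h3 h4
  refine ⟨h3.1, h4.1, h3.2, h4.2, ?_⟩
  have := ENNReal.toReal_mono hS h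
  rwa [ENNReal.toReal_add h1 h2, ENNReal.toReal_mul, ENNReal.toReal_mul,
    ENNReal.toReal_add h3.1 h3.2, ENNReal.toReal_add h4.1 h4.2,
    ENNReal.toReal_ofReal (by linarith), ENNReal.toReal_ofReal ht.le] at this

lemma toReal_le_add {S a : ℝ≥0∞} {d : ℝ} (hd : 0 ≤ d) (ha : a ≠ ⊤)
    (h : S ≤ a + ENNReal.ofReal d) : S.toReal ≤ a.toReal + d := by
  have := ENNReal.toReal_mono (by simp [ha]) h
  rwa [ENNReal.toReal_add ha (by simp), ENNReal.toReal_ofReal hd] at this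

lemma arithA {t : ℝ} (ht : 0 < t) (ht1 : t < 1) {S a b X Y : ℝ≥0∞} (hS : S ≠ ⊤)
    (h : ENNReal.ofReal (1 - t) * (a + X) + ENNReal.ofReal t * (b + Y) ≤ S)
    (ha : S ≤ a + ENNReal.ofReal t) : Y ≤ S + 1 := by
  obtain ⟨h1, h2, h3, h4, h5⟩ := arith_real ht ht1 hS h
  have h6 := toReal_le_add ht.le h1 ha
  rw [← ENNReal.toReal_le_toReal h4 (by simp [hS]), ENNReal.toReal_add hS (by simp)]
  have : t * Y.toReal ≤ t * (S.toReal + 1) := by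
    nlinarith [mul_le_mul_of_nonneg_left h6 (by linarith : 0 ≤ 1 - t),
      mul_nonneg (by linarith : 0 ≤ 1 - t) (X.toReal_nonneg), mul_nonneg ht.le (b.toReal_nonneg),
      mul_nonneg ht.le ht.le]
  simpa using le_of_mul_le_mul_left this ht

lemma arithB {S a b X Y : ℝ≥0∞} {d : ℝ} (hd : 0 ≤ d) (hS : S ≠ ⊤)
    (h : ENNReal.ofReal (1 - 1/2) * (a + X) + ENNReal.ofReal (1/2) * (b + Y) ≤ S)
    (ha : S ≤ a + ENNReal.ofReal d) (hb : S ≤ b + ENNReal.ofReal d) :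
    X + Y ≤ ENNReal.ofReal (2 * d) := by
  obtain ⟨h1, h2, h3, h4, h5⟩ := arith_real (by norm_num) (by norm_num) hS h
  have h6 := toReal_le_add hd h1 ha
  have h7 := toReal_le_add hd h2 hb
  rw [← ENNReal.toReal_le_toReal (by simp [h3, h4]) ENNReal.ofReal_ne_top, ENNReal.toReal_add h3 h4,
    ENNReal.toReal_ofReal (by linarith)]
  linarith

variable (Q : Measure ℝ) [IsProbabilityMeasure Q]

lemma exists_near {S : ℝ≥0∞} (hS : S ≠ ⊤) (hsup : S = ⨆ ρ : {ρ : Measure ℝ // Prior Q ρ}, IG Q ρ)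
    {d : ℝ} (hd : 0 < d) : ∃ ρ, Prior Q ρ ∧ S ≤ IG Q ρ + ENNReal.ofReal d := by
  by_contra! hc
  have : Nonempty {ρ : Measure ℝ // Prior Q ρ} := ⟨⟨_, dirac_prior Q (zero_mem_Γ Q)⟩⟩
  have h1 : S + ENNReal.ofReal d ≤ S := by
    conv_lhs => rw [hsup]
    rw [ENNReal.iSup_add]
    exact iSup_le fun ρ => (hc ρ.1 ρ.2).le
  exact absurd (ENNReal.lt_add_right hS (by simpa using hd)) (not_lt.2 h1)

/-- L2 closeness of square roots of near-optimal mixtures. -/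
lemma near_close {S : ℝ≥0∞} (hS : S ≠ ⊤) (hsup : ∀ ρ, Prior Q ρ → IG Q ρ ≤ S) {d : ℝ} (hd : 0 ≤ d)
    {ρ₁ ρ₂ : Measure ℝ} (h1 : Prior Q ρ₁) (h2 : Prior Q ρ₂)
    (k1 : S ≤ IG Q ρ₁ + ENNReal.ofReal d) (k2 : S ≤ IG Q ρ₂ + ENNReal.ofReal d) :
    ∫⁻ x, ENNReal.ofReal ((√(pbar Q ρ₁ x) - √(pbar Q ρ₂ x)) ^ 2) ∂Q ≤ ENNReal.ofReal (4 * d) := by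
  have := h1.1
  have := h2.1
  have m1 := measurable_pbar Q ρ₁
  have m2 := measurable_pbar Q ρ₂
  have h := mix_IG Q (t := 1/2) (by norm_num) (by norm_num) h1 h2
  have hle := hsup _ (mix_prior Q (t := 1/2) (by norm_num) (by norm_num) h1 h2)
  rw [h] at hle
  have hB := arithB hd hS hle k1 k2
  rw [← lintegral_add_left (measurable_GG m1 (by fun_prop)).ennreal_ofReal] at hB
  calc _ ≤ ∫⁻ x, 2 * (ENNReal.ofReal (GG (pbar Q ρ₁ x) ((1 - 1/2) * pbar Q ρ₁ x + 1/2 * pbar Q ρ₂ x))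
          + ENNReal.ofReal (GG (pbar Q ρ₂ x) ((1 - 1/2) * pbar Q ρ₁ x + 1/2 * pbar Q ρ₂ x))) ∂Q := by
        apply lintegral_mono_ae
        filter_upwards [pbar_ae Q h1, pbar_ae Q h2] with x a b
        have hp : 0 < (1 - 1/2) * pbar Q ρ₁ x + 1/2 * pbar Q ρ₂ x := by linarith [a.1, b.1]
        rw [← ENNReal.ofReal_add (GG_nonneg a.1.le hp) (GG_nonneg b.1.le hp),
          (by simp : (2 : ℝ≥0∞) = ENNReal.ofReal 2), ← ENNReal.ofReal_mul (by norm_num)]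
        exact ENNReal.ofReal_le_ofReal (GG_half a.1 b.1)
    _ ≤ 2 * ENNReal.ofReal (2 * d) := by
        rw [lintegral_const_mul' _ _ (by simp)]
        gcongr
    _ = ENNReal.ofReal (4 * d) := by
        rw [(by simp : (2 : ℝ≥0∞) = ENNReal.ofReal 2), ← ENNReal.ofReal_mul (by norm_num)]
        congr 1; ring

lemma exists_limit {r : ℕ → ℝ → ℝ} (hr : ∀ n, Measurable (r n))
    (hc : ∀ N n m, N ≤ n → N ≤ m → ∫⁻ x, ENNReal.ofReal ((r n x - r m x) ^ 2) ∂Q ≤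
      ENNReal.ofReal (4 * (1/16) ^ (N+1))) :
    ∃ l : ℝ → ℝ, Measurable l ∧ ∀ᵐ x ∂Q, Tendsto (fun n => r n x) atTop (𝓝 (l x)) := by
  have hT : ∀ᵐ x ∂Q, ∃ l : ℝ, Tendsto (fun n => r n x) atTop (𝓝 l) := by
    apply Lp.ae_tendsto_of_cauchy_eLpNorm (p := 2) (B := fun N => ENNReal.ofReal ((1/4) ^ N))
      (fun n => (hr n).aestronglyMeasurable) (by norm_num)
    · rw [← ENNReal.ofReal_tsum_of_nonneg (fun n => by positivity)
        (summable_geometric_of_lt_one (by norm_num) (by norm_num))]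
      simp
    · intro N n m hn hm
      have h := hc N n m hn hm
      rw [eLpNorm_eq_lintegral_rpow_enorm_toReal (by norm_num) (by norm_num)]
      have e : ∫⁻ x, ‖(r n - r m) x‖ₑ ^ (2 : ℝ≥0∞).toReal ∂Q =
          ∫⁻ x, ENNReal.ofReal ((r n x - r m x) ^ 2) ∂Q := by
        apply lintegral_congr
        intro x
        simp only [Pi.sub_apply, ENNReal.toReal_ofNat, ENNReal.rpow_ofNat]
        rw [Real.enorm_eq_ofReal_abs, ← ENNReal.ofReal_pow (abs_nonneg _), sq_abs]
      rw [e]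
      have h2 : ∫⁻ x, ENNReal.ofReal ((r n x - r m x) ^ 2) ∂Q < (ENNReal.ofReal ((1/4) ^ N)) ^ (2:ℝ) := by
        refine h.trans_lt ?_
        rw [ENNReal.rpow_ofNat, ← ENNReal.ofReal_pow (by positivity)]
        rw [ENNReal.ofReal_lt_ofReal_iff (by positivity)]
        rw [← pow_mul, mul_comm N 2, pow_mul, pow_succ]
        norm_num
        have : (0:ℝ) < (1/16) ^ N := by positivity
        linarith
      have := ENNReal.rpow_lt_rpow h2 (by norm_num : (0:ℝ) < 1/2)
      rw [← ENNReal.rpow_mul] at this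
      simpa using this
  exact measurable_limit_of_tendsto_metrizable_ae (fun n => (hr n).aemeasurable) hT

lemma GG_add_one {a b : ℝ} (ha : 0 ≤ a) (hb : 0 < b) : GG a (b + 1) ≤ GG a b + 1 := by
  unfold GG
  rcases ha.eq_or_lt with h | h
  · subst h; simp
  · have : Real.log (a / (b + 1)) ≤ Real.log (a / b) := by
      apply Real.log_le_log (by positivity)
      gcongr; linarith
    nlinarith

lemma GG_div {a b N : ℝ} (ha : 0 ≤ a) (hb : 0 < b) (hN : 1 ≤ N) (hN2 : N ≤ 2) :
    GG a (b / N) ≤ GG a b + a := by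
  have hN0 : 0 < N := by linarith
  rw [GG_sub ha hb (div_pos hb hN0)]
  have e : b / (b / N) = N := by field_simp
  rw [e]
  have h1 : Real.log N ≤ 1 := by have := Real.log_le_sub_one_of_pos hN0; linarith
  have h2 : b / N ≤ b := div_le_self hb.le hN
  nlinarith

lemma backward_s8 {S : ℝ≥0∞} (hS : S ≠ ⊤)
    (hsup : S = ⨆ ρ : {ρ : Measure ℝ // Prior Q ρ}, IG Q ρ) :
    ∃ m : Measure ℝ, IsProbabilityMeasure m ∧ ∀ β ∈ Γcan Q, KL (Pexp Q β) m ≤ S + 3 := by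
  have hle : ∀ ρ, Prior Q ρ → IG Q ρ ≤ S := by
    intro ρ h
    rw [hsup]
    exact le_iSup (fun ρ : {ρ : Measure ℝ // Prior Q ρ} => IG Q ρ) ⟨ρ, h⟩
  set t : ℕ → ℝ := fun n => (1/16) ^ (n+1) with ht
  have tpos : ∀ n, 0 < t n := fun n => by simp only [ht]; positivity
  have tlt : ∀ n, t n < 1 := fun n => pow_lt_one₀ (by norm_num) (by norm_num) (by simp)
  have tanti : ∀ N n, N ≤ n → t n ≤ t N := fun N n h =>
    pow_le_pow_of_le_one (by norm_num) (by norm_num) (by omega)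
  have tlim : Tendsto t atTop (𝓝 0) :=
    (tendsto_pow_atTop_nhds_zero_of_lt_one (by norm_num : (0:ℝ) ≤ 1/16) (by norm_num)).comp
      (tendsto_add_atTop_nat 1)
  choose ρ hρ hnear using fun n => exists_near Q hS hsup (tpos n)
  have hmeas : ∀ n, Measurable (pbar Q (ρ n)) := fun n => by
    have := (hρ n).1
    exact measurable_pbar Q (ρ n)
  obtain ⟨l, hlm, hl⟩ := exists_limit Q (r := fun n x => √(pbar Q (ρ n) x))
    (fun n => (hmeas n).sqrt) (by
      intro N n m hn hm
      apply near_close Q hS hle (tpos N).le (hρ n) (hρ m)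
      · refine (hnear n).trans ?_
        gcongr
        exact tanti N n hn
      · refine (hnear m).trans ?_
        gcongr
        exact tanti N m hm)
  have hpb0 : ∀ n x, 0 ≤ pbar Q (ρ n) x := fun n x => ENNReal.toReal_nonneg
  have hlim : ∀ᵐ x ∂Q, Tendsto (fun n => pbar Q (ρ n) x) atTop (𝓝 (l x ^ 2)) := by
    filter_upwards [hl] with x hx
    have := hx.pow 2
    simpa [Real.sq_sqrt (hpb0 _ x)] using this
  have hq1 : ∫⁻ x, ENNReal.ofReal (l x ^ 2) ∂Q ≤ 1 := by
    calc _ ≤ ∫⁻ x, liminf (fun n => ENNReal.ofReal (pbar Q (ρ n) x)) atTop ∂Q := by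
          apply lintegral_mono_ae
          filter_upwards [hlim] with x hx
          exact ((ENNReal.continuous_ofReal.tendsto _).comp hx).liminf_eq.ge
      _ ≤ liminf (fun n => ∫⁻ x, ENNReal.ofReal (pbar Q (ρ n) x) ∂Q) atTop :=
          lintegral_liminf_le fun n => (hmeas n).ennreal_ofReal
      _ = 1 := by simp [lintegral_pbar Q (hρ _)]
  set I := ∫⁻ x, ENNReal.ofReal (l x ^ 2) ∂Q with hI
  have hItop : I ≠ ⊤ := ne_top_of_le_ne_top (by simp) hq1
  set N : ℝ := I.toReal + 1 with hN
  have hN1 : 1 ≤ N := by simp [hN]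
  have hN2 : N ≤ 2 := by
    have : I.toReal ≤ 1 := ENNReal.toReal_le_of_le_ofReal zero_le_one (by simpa using hq1)
    linarith
  have hN0 : 0 < N := by linarith
  set q : ℝ → ℝ := fun x => (l x ^ 2 + 1) / N with hqdef
  have hqm : Measurable q := by simp only [hqdef]; fun_prop
  have hqpos : ∀ x, 0 < q x := fun x => by simp only [hqdef]; positivity
  have hqint : ∫⁻ x, ENNReal.ofReal (q x) ∂Q = 1 := by
    have : ∀ x, ENNReal.ofReal (q x) = (ENNReal.ofReal (l x ^ 2) + 1) * (ENNReal.ofReal N)⁻¹ := by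
      intro x
      simp only [hqdef]
      rw [ENNReal.ofReal_div_of_pos hN0, ENNReal.ofReal_add (sq_nonneg _) zero_le_one]
      simp [div_eq_mul_inv]
    simp_rw [this]
    rw [lintegral_mul_const _ (by fun_prop), lintegral_add_right _ measurable_const, ← hI]
    simp only [lintegral_one, measure_univ]
    have : ENNReal.ofReal N = I + 1 := by
      rw [hN, ENNReal.ofReal_add ENNReal.toReal_nonneg zero_le_one, ENNReal.ofReal_toReal hItop]
      simp
    rw [this]
    exact ENNReal.mul_inv_cancel (by simp) (by simp [hItop])
  refine ⟨Q.withDensity (fun x => ENNReal.ofReal (q x)), ⟨by simp [hqint]⟩, ?_⟩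
  have hprob : IsProbabilityMeasure (Q.withDensity (fun x => ENNReal.ofReal (q x))) :=
    ⟨by simp [hqint]⟩
  intro β hβ
  have hpm := measurable_pd_right Q β
  refine (KL_le_G Q hβ (ac_withDensity Q hqm.ennreal_ofReal (ae_of_all _ fun x => by
    simpa using hqpos x)) (withDensity_absolutelyContinuous _ _) hqm (ae_of_all _ hqpos)
    (Measure.rnDeriv_withDensity Q hqm.ennreal_ofReal)).trans ?_
  have key : ∫⁻ x, ENNReal.ofReal (GG (pd Q β x) (l x ^ 2 + 1)) ∂Q ≤ S + 2 := by
    set b : ℕ → ℝ → ℝ := fun n x => (1 - t n) * pbar Q (ρ n) x + t n * pd Q β x with hb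
    have hbm : ∀ n, Measurable (b n) := fun n => by
      have := hmeas n
      simp only [hb]; fun_prop
    have hbpos : ∀ n x, 0 < b n x := fun n x => by
      have h1 := mul_pos (tpos n) (pd_pos Q hβ x)
      have h2 := mul_nonneg (by linarith [tlt n] : 0 ≤ 1 - t n) (hpb0 n x)
      simp only [hb]; linarith
    have hbG : ∀ n, ∫⁻ x, ENNReal.ofReal (GG (pd Q β x) (b n x + 1)) ∂Q ≤ S + 2 := by
      intro n
      have h1 := mix_IG Q (tpos n) (tlt n) (hρ n) (dirac_prior Q hβ)
      have h2 := hle _ (mix_prior Q (tpos n) (tlt n) (hρ n) (dirac_prior Q hβ))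
      rw [h1] at h2
      have h3 := arithA (tpos n) (tlt n) hS h2 (hnear n)
      simp only [dirac_pbar] at h3
      calc _ ≤ ∫⁻ x, (ENNReal.ofReal (GG (pd Q β x) (b n x)) + 1) ∂Q := by
            apply lintegral_mono
            intro x
            refine (ENNReal.ofReal_le_ofReal (GG_add_one (pd_nonneg Q β x) (hbpos n x))).trans ?_
            rw [ENNReal.ofReal_add (GG_nonneg (pd_nonneg Q β x) (hbpos n x)) zero_le_one]
            simp
        _ ≤ (S + 1) + 1 := by
            rw [lintegral_add_right _ measurable_const]
            simp only [lintegral_one, measure_univ]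
            gcongr
        _ = S + 2 := by rw [add_assoc]; norm_num
    calc _ ≤ ∫⁻ x, liminf (fun n => ENNReal.ofReal (GG (pd Q β x) (b n x + 1))) atTop ∂Q := by
          apply lintegral_mono_ae
          filter_upwards [hlim] with x hx
          have hbl : Tendsto (fun n => b n x + 1) atTop (𝓝 (l x ^ 2 + 1)) := by
            have h1 : Tendsto (fun n => (1 - t n) * pbar Q (ρ n) x + t n * pd Q β x + 1) atTop
              (𝓝 ((1 - 0) * l x ^ 2 + 0 * pd Q β x + 1)) :=
              (((tlim.const_sub 1).mul hx).add (tlim.mul_const _)).add_const 1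
            simpa [hb] using h1
          have hne : l x ^ 2 + 1 ≠ 0 := by positivity
          have hG : Tendsto (fun n => GG (pd Q β x) (b n x + 1)) atTop
              (𝓝 (GG (pd Q β x) (l x ^ 2 + 1))) := by
            unfold GG
            have hd : pd Q β x / (l x ^ 2 + 1) ≠ 0 := div_ne_zero (pd_pos Q hβ x).ne' hne
            exact ((((tendsto_const_nhds.div hbl hne).log hd).const_mul _).add hbl).sub_const _
          exact ((ENNReal.continuous_ofReal.tendsto _).comp hG).liminf_eq.ge
      _ ≤ liminf (fun n => ∫⁻ x, ENNReal.ofReal (GG (pd Q β x) (b n x + 1)) ∂Q) atTop :=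
          lintegral_liminf_le fun n => (measurable_GG hpm ((hbm n).add_const 1)).ennreal_ofReal
      _ ≤ liminf (fun _ : ℕ => S + 2) atTop := liminf_le_liminf (Eventually.of_forall hbG)
      _ = S + 2 := by simp
  calc _ ≤ ∫⁻ x, (ENNReal.ofReal (GG (pd Q β x) (l x ^ 2 + 1)) + ENNReal.ofReal (pd Q β x)) ∂Q := by
        apply lintegral_mono
        intro x
        have hp : 0 < l x ^ 2 + 1 := by positivity
        beta_reduce
        rw [← ENNReal.ofReal_add (GG_nonneg (pd_nonneg Q β x) hp) (pd_nonneg Q β x)]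
        exact ENNReal.ofReal_le_ofReal (GG_div (pd_nonneg Q β x) hp hN1 hN2)
    _ ≤ (S + 2) + 1 := by
        rw [lintegral_add_right _ hpm.ennreal_ofReal, lintegral_pd Q hβ]
        gcongr
    _ = S + 3 := by rw [add_assoc]; norm_num

end three

/-- minimax expected redundancy is finite iff the channel
β ↦ P_β has finite capacity. -/
theorem redundancy_finite_iff_capacity_finite (Q : Measure ℝ)
    [IsProbabilityMeasure Q] (hlt : LeftTruncated Q) :
    (⨅ Q' ∈ {m : Measure ℝ | IsProbabilityMeasure m},
        ⨆ β ∈ Γcan Q, KL (Pexp Q β) Q') < ⊤ ↔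
      (⨆ pri ∈ {pri : Measure ℝ | IsProbabilityMeasure pri ∧ pri (Γcan Q) = 1},
        ∫⁻ β, KL (Pexp Q β) (pri.bind (Pexp Q)) ∂pri) < ⊤ := by 
  constructor
  · intro h
    simp only [iInf_lt_iff] at h
    obtain ⟨m, hm, hlt⟩ := h
    have : IsProbabilityMeasure m := hm
    refine lt_of_le_of_lt ?_ hlt
    refine iSup₂_le fun pri hpri => ?_
    rw [IG_eq Q hpri]
    exact forward_s8 Q hlt (fun β hβ => le_iSup₂ (f := fun β (_ : β ∈ Γcan Q) => KL (Pexp Q β) m) β hβ)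
      hpri
  · intro h
    have hle : (⨆ ρ : {ρ : Measure ℝ // Prior Q ρ}, IG Q ρ) ≤
        (⨆ pri ∈ {pri : Measure ℝ | IsProbabilityMeasure pri ∧ pri (Γcan Q) = 1},
          ∫⁻ β, KL (Pexp Q β) (pri.bind (Pexp Q)) ∂pri) := by
      refine iSup_le fun ρ => ?_
      rw [← IG_eq Q ρ.2]
      exact le_iSup₂ (f := fun (pri : Measure ℝ)
        (_ : pri ∈ {pri : Measure ℝ | IsProbabilityMeasure pri ∧ pri (Γcan Q) = 1}) =>
          ∫⁻ β, KL (Pexp Q β) (pri.bind (Pexp Q)) ∂pri) ρ.1 ρ.2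
    have hne := (hle.trans_lt h).ne
    obtain ⟨m, hm, hb⟩ := backward_s8 Q hne rfl
    refine lt_of_le_of_lt (iInf₂_le m hm) ?_
    refine lt_of_le_of_lt (iSup₂_le hb) ?_
    exact ENNReal.add_lt_top.2 ⟨hle.trans_lt h, by simp⟩
end
end

section
/- For a one-dimensional left-truncated exponential family, if the Shtarkov integral S = ∫ sup_{β ∈ Γ}(e^{βx}/Z(β)) dQ(x) is infinite, then the Jeffreys integral J = ∫_Γ I_β^{1/2} dβ is infinite. -/
open scoped ENNReal NNReal
open MeasureTheory Real Set Filter Topology Asymptotics ProbabilityTheory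

noncomputable section

lemma aux_mgf (Q : Measure ℝ) (β : ℝ) : mgf id Q β = (Z Q β).toReal := by
  rw [mgf, integral_eq_lintegral_of_nonneg_ae (ae_of_all _ fun x => (exp_pos _).le)
    (by fun_prop)]
  rfl

lemma aux_psi (Q : Measure ℝ) : ψ Q = cgf id Q := by
  ext β
  rw [ψ, cgf, aux_mgf]

lemma aux_Γ (Q : Measure ℝ) : Γcan Q = integrableExpSet id Q := by
  ext β
  rw [Γcan, integrableExpSet, mem_ofPred_eq, mem_ofPred_eq, Z]
  constructor
  · intro h
    refine ⟨by fun_prop, ?_⟩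
    rw [hasFiniteIntegral_iff_ofReal (ae_of_all _ fun x => (exp_pos _).le)]
    exact h
  · intro h
    have := h.2
    rwa [hasFiniteIntegral_iff_ofReal (ae_of_all _ fun x => (exp_pos _).le)] at this

lemma aux_I (Q : Measure ℝ) (ψ' I : ℝ → ℝ)
    (hd1 : ∀ β ∈ interior (Γcan Q), HasDerivAt (ψ Q) (ψ' β) β)
    (hd2 : ∀ β ∈ interior (Γcan Q), HasDerivAt ψ' (I β) β) (β : ℝ) (hβ : β ∈ interior (Γcan Q)) :
    I β = Var[id; Q.tilted (fun x => β * id x)] := by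
  rw [variance_tilted_mul (by rwa [← aux_Γ]), ← aux_psi, iteratedDeriv_succ, iteratedDeriv_one]
  rw [← (hd2 β hβ).deriv]
  apply Filter.EventuallyEq.deriv_eq
  filter_upwards [isOpen_interior.mem_nhds hβ] with t ht
  exact (hd1 t ht).deriv.symm

lemma aux_cs {P : Measure ℝ} [IsProbabilityMeasure P] (h : MemLp id 2 P) (A : Set ℝ) :
    |∫ x in A, (x - ∫ y, y ∂P) ∂P| ≤ √(Var[id; P]) := by
  set c := ∫ y, y ∂P with hc
  have hm : MemLp (fun x : ℝ => x - c) 2 P := h.sub (memLp_const c)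
  have hi : Integrable (fun x : ℝ => x - c) P := hm.integrable (by norm_num)
  have h1 : |∫ x in A, (x - c) ∂P| ≤ ∫ x, |x - c| ∂P := by
    refine (abs_integral_le_integral_abs).trans ?_
    exact setIntegral_le_integral hi.abs (ae_of_all _ fun x => abs_nonneg _)
  refine h1.trans ?_
  apply Real.le_sqrt_of_sq_le
  have h2 := variance_nonneg (fun x : ℝ => |x - c|) P
  have hma : MemLp (fun x : ℝ => |x - c|) 2 P := hm.abs
  rw [variance_eq_sub hma] at h2
  rw [variance_eq_integral aemeasurable_id]
  simp only [Pi.pow_apply, sq_abs, id] at h2 ⊢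
  rw [← hc]
  linarith

lemma aux_real (Q : Measure ℝ) [IsProbabilityMeasure Q] {A : Set ℝ} (hA : MeasurableSet A) (β : ℝ) :
    (Q.tilted (fun x => β * id x)).real A = mgf id (Q.restrict A) β / mgf id Q β := by
  rw [Measure.real, tilted_mul_apply_eq_ofReal_integral_mgf' hA, integral_div,
    ENNReal.toReal_ofReal]
  · rfl
  · exact div_nonneg (integral_nonneg fun x => (exp_pos _).le) mgf_nonneg

lemma aux_deriv (Q : Measure ℝ) [IsProbabilityMeasure Q] {A : Set ℝ} (hA : MeasurableSet A) {β : ℝ}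
    (hβ : β ∈ interior (integrableExpSet id Q)) :
    |deriv (fun β => mgf id (Q.restrict A) β / mgf id Q β) β|
      ≤ √(Var[id; Q.tilted (fun x => β * id x)]) := by
  have hint := interior_subset hβ
  have hsub : integrableExpSet id Q ⊆ integrableExpSet id (Q.restrict A) :=
    fun t ht => Integrable.restrict ht
  have hpos : 0 < mgf id Q β := mgf_pos hint
  have := isProbabilityMeasure_tilted (μ := Q) (f := fun x => β * id x) hint
  have hN := hasDerivAt_mgf (interior_mono hsub hβ)
  have hZ := hasDerivAt_mgf hβ
  have hD := (hN.div hZ hpos.ne').deriv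
  rw [show (fun β => mgf id (Q.restrict A) β / mgf id Q β) = mgf id (Q.restrict A) / mgf id Q from rfl,
    hD]
  have hmem : MemLp id 2 (Q.tilted (fun x => β * id x)) := memLp_tilted_mul hβ 2
  refine le_trans (le_of_eq ?_) (aux_cs hmem A)
  congr 1
  have hc : ∫ y, y ∂(Q.tilted (fun x => β * id x)) = (∫ x, x * exp (β * x) ∂Q) / mgf id Q β := by
    rw [integral_tilted_mul_eq_mgf (fun y => y), ← integral_div]
    congr 1; ext x; simp; ring
  rw [hc, setIntegral_tilted_mul_eq_mgf' _ hA]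
  set d := (∫ x, x * exp (β * x) ∂Q) / mgf id Q β with hd
  have e1 : ∫ x in A, (exp (β * id x) / mgf id Q β) • (x - d) ∂Q
      = (∫ x in A, x * exp (β * x) ∂Q) / mgf id Q β
        - d * (mgf id (Q.restrict A) β / mgf id Q β) := by
    rw [show mgf id (Q.restrict A) β = ∫ x in A, exp (β * x) ∂Q from rfl, ← integral_div, ← integral_div, ← integral_const_mul, ← integral_sub]
    · congr 1; ext x; simp; ring
    · have := integrable_pow_mul_exp_of_mem_interior_integrableExpSet hβ 1
      simp only [pow_one, id] at this
      exact this.restrict.div_const _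
    · exact ((Integrable.restrict hint).div_const _).const_mul _
  rw [e1, hd]
  simp only [id]
  generalize (∫ x in A, x * exp (β * x) ∂Q) = u
  generalize (∫ x, x * exp (β * x) ∂Q) = v
  field_simp

lemma aux_tv (Q : Measure ℝ) [IsProbabilityMeasure Q] (ψ' I : ℝ → ℝ)
    (hd1 : ∀ β ∈ interior (Γcan Q), HasDerivAt (ψ Q) (ψ' β) β)
    (hd2 : ∀ β ∈ interior (Γcan Q), HasDerivAt ψ' (I β) β) {A : Set ℝ} (hA : MeasurableSet A)
    {s t : ℝ} (hst : s ≤ t) (hsub : Icc s t ⊆ interior (Γcan Q)) :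
    ENNReal.ofReal |(Q.tilted (fun x => t * id x)).real A - (Q.tilted (fun x => s * id x)).real A|
      ≤ ((volume.restrict (Γcan Q)).withDensity fun β => ENNReal.ofReal √(I β)) (Icc s t) := by
  have hsubs : integrableExpSet id Q ⊆ integrableExpSet id (Q.restrict A) :=
    fun t ht => Integrable.restrict ht
  have hC : ContDiffOn ℝ 1 (fun β => mgf id (Q.restrict A) β / mgf id Q β) (Icc s t) := by
    intro β hβ
    have hβ' : β ∈ interior (integrableExpSet id Q) := by rw [← aux_Γ]; exact hsub hβ
    have hpos : 0 < mgf id Q β := by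
      have := interior_subset hβ'
      exact mgf_pos this
    exact (((analyticAt_mgf (interior_mono hsubs hβ')).div (analyticAt_mgf hβ')
      hpos.ne').contDiffAt).contDiffWithinAt
  have h := enorm_sub_le_lintegral_deriv_of_contDiffOn_Icc hC hst
  rw [aux_real Q hA, aux_real Q hA, ← Real.norm_eq_abs, ofReal_norm]
  refine h.trans ?_
  rw [withDensity_apply _ measurableSet_Icc, Measure.restrict_restrict measurableSet_Icc,
    inter_eq_left.2 (hsub.trans interior_subset)]
  refine setLIntegral_mono' measurableSet_Icc fun β hβ => ?_
  rw [← ofReal_norm, aux_I Q ψ' I hd1 hd2 β (hsub hβ)]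
  apply ENNReal.ofReal_le_ofReal
  rw [Real.norm_eq_abs]
  exact aux_deriv Q hA (by rw [← aux_Γ]; exact hsub hβ)

lemma aux_cdf (μ : Measure ℝ) [IsProbabilityMeasure μ] :
    (∃ c, μ {c} ≠ 0 ∧ μ (Ioi c) = 0) ∨ ∃ s, μ (Ioi s) ≠ 0 ∧ 1 / 2 < μ.real (Iic s) := by
  by_contra! hcon
  obtain ⟨h1, h2⟩ := hcon
  have hG : ∀ s, cdf μ s = 1 ∨ cdf μ s ≤ 1 / 2 := by
    intro s
    by_cases hs : μ (Ioi s) = 0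
    · left
      rw [cdf_eq_real, measureReal_def, (prob_compl_eq_zero_iff measurableSet_Iic).1 (by simpa using hs)]
      simp
    · right
      rw [cdf_eq_real]; exact h2 s hs
  have hone : ∀ s, 1 / 2 < cdf μ s → cdf μ s = 1 := fun s hs => (hG s).resolve_right (by linarith)
  have ht := tendsto_cdf_atTop μ
  have hb := tendsto_cdf_atBot μ
  obtain ⟨s1, hs1⟩ := (ht.eventually (lt_mem_nhds (show (1:ℝ)/2 < 1 by norm_num))).exists
  obtain ⟨s0, hs0⟩ := (hb.eventually (gt_mem_nhds (show (0:ℝ) < 1 by norm_num))).exists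
  set T := {s | cdf μ s = 1} with hT
  have hTne : T.Nonempty := ⟨s1, hone s1 hs1⟩
  have hTb : BddBelow T := ⟨s0, fun s hs => by
    by_contra! hlt
    have := monotone_cdf μ hlt.le
    have hs' : cdf μ s = 1 := hs
    linarith⟩
  set c := sInf T with hc
  have hgt : ∀ s, c < s → cdf μ s = 1 := by
    intro s hs
    obtain ⟨u, hu, hus⟩ := exists_lt_of_csInf_lt hTne hs
    have := monotone_cdf μ hus.le
    have hu' : cdf μ u = 1 := hu
    exact le_antisymm (cdf_le_one μ s) (hu' ▸ this)
  have hlt : ∀ s, s < c → cdf μ s ≤ 1 / 2 := by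
    intro s hs
    refine (hG s).resolve_left fun h => ?_
    exact absurd (csInf_le hTb h) (not_le.2 hs)
  have hc1 : cdf μ c = 1 := by
    have hr : Tendsto (cdf μ) (𝓝[>] c) (𝓝 (cdf μ c)) :=
      ((cdf μ).right_continuous c).tendsto.mono_left (nhdsWithin_mono _ Ioi_subset_Ici_self)
    refine tendsto_nhds_unique hr (tendsto_const_nhds.congr' ?_)
    filter_upwards [self_mem_nhdsWithin] with s hs
    exact (hgt s hs).symm
  have hl : Function.leftLim (cdf μ) c ≤ 1 / 2 := by
    refine le_of_tendsto ((monotone_cdf μ).tendsto_leftLim c) ?_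
    filter_upwards [self_mem_nhdsWithin] with s hs using hlt s hs
  refine h1 c ?_ ?_
  · rw [← measure_cdf μ, StieltjesFunction.measure_singleton, hc1]
    simp only [ne_eq, ENNReal.ofReal_eq_zero, not_le]
    linarith
  · have : μ.real (Iic c) = 1 := by rw [← cdf_eq_real, hc1]
    have h3 : μ (Iic c) = 1 := by
      rw [measureReal_def] at this
      exact (ENNReal.toReal_eq_one_iff _).1 this
    rw [← compl_Iic]
    exact (prob_compl_eq_zero_iff measurableSet_Iic).2 h3

lemma aux_real' (Q : Measure ℝ) [IsProbabilityMeasure Q] (X : ℝ → ℝ) {A : Set ℝ}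
    (hA : MeasurableSet A) (β : ℝ) :
    (Q.tilted (fun x => β * X x)).real A = mgf X (Q.restrict A) β / mgf X Q β := by
  rw [Measure.real, tilted_mul_apply_eq_ofReal_integral_mgf' hA, integral_div,
    ENNReal.toReal_ofReal]
  · rfl
  · exact div_nonneg (integral_nonneg fun x => (exp_pos _).le) mgf_nonneg

lemma aux_num (Q : Measure ℝ) [IsProbabilityMeasure Q] (X : ℝ → ℝ) (hX : Measurable X)
    {β : ℝ} (hβ : 0 ≤ β) (hi : Integrable (fun x => exp (β * X x)) Q) (s : ℝ) :
    mgf X (Q.restrict (X ⁻¹' Iic s)) β ≤ exp (β * s) := by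
  have h1 : mgf X (Q.restrict (X ⁻¹' Iic s)) β ≤ ∫ x in X ⁻¹' Iic s, exp (β * s) ∂Q := by
    refine setIntegral_mono_on hi.integrableOn (integrable_const _) (hX measurableSet_Iic) ?_
    intro x hx
    exact exp_le_exp.2 (mul_le_mul_of_nonneg_left hx hβ)
  refine h1.trans ?_
  rw [setIntegral_const, smul_eq_mul]
  exact mul_le_of_le_one_left (exp_pos _).le measureReal_le_one

lemma aux_top (Q : Measure ℝ) [IsProbabilityMeasure Q] (X : ℝ → ℝ) (hX : Measurable X) (β0 : ℝ)
    (h0 : Integrable (fun x => exp (β0 * X x)) Q)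
    (h : ∀ β, β0 ≤ β → Integrable (fun x => exp (β * X x)) Q ∧ ∀ A, MeasurableSet A →
      |(Q.tilted (fun x => β * X x)).real A - (Q.tilted (fun x => β0 * X x)).real A| ≤ 1 / 4) :
    ∃ c, Q (X ⁻¹' {c}) ≠ 0 ∧ ∀ᵐ x ∂Q, X x ≤ c := by
  have hP := isProbabilityMeasure_tilted h0
  set P := Q.tilted (fun x => β0 * X x) with hPdef
  have hPQ : P ≪ Q := tilted_absolutelyContinuous _ _
  have hQP : Q ≪ P := absolutelyContinuous_tilted h0
  have hM : IsProbabilityMeasure (P.map X) := Measure.isProbabilityMeasure_map hX.aemeasurable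
  rcases aux_cdf (P.map X) with ⟨c, hc1, hc2⟩ | ⟨s, hs1, hs2⟩
  · rw [Measure.map_apply hX (measurableSet_singleton c)] at hc1
    rw [Measure.map_apply hX measurableSet_Ioi] at hc2
    refine ⟨c, fun h => hc1 (hPQ h), ?_⟩
    have := hQP hc2
    rw [ae_iff]
    convert this using 2
    ext x; simp
  · exfalso
    rw [Measure.map_apply hX measurableSet_Ioi] at hs1
    rw [map_measureReal_apply hX measurableSet_Iic] at hs2
    have hs3 : Q (X ⁻¹' Ioi s) ≠ 0 := fun h => hs1 (hPQ h)
    obtain ⟨s', hss', hs'⟩ : ∃ s', s < s' ∧ Q {x | s' ≤ X x} ≠ 0 := by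
      by_contra! hcon
      apply hs3
      refine measure_mono_null (t := ⋃ n : ℕ, {x | s + 1 / ((n : ℝ) + 1) ≤ X x}) ?_
        (measure_iUnion_null fun n => hcon _ (by
          have : (0:ℝ) < 1 / ((n : ℝ) + 1) := by positivity
          linarith))
      intro x hx
      have hx' : 0 < X x - s := sub_pos.2 hx
      obtain ⟨n, hn⟩ := exists_nat_one_div_lt hx'
      refine mem_iUnion.2 ⟨n, ?_⟩
      change s + 1 / ((n : ℝ) + 1) ≤ X x
      linarith
    set q := Q.real {x | s' ≤ X x} with hq
    have hqpos : 0 < q := by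
      rw [hq, measureReal_def]
      exact ENNReal.toReal_pos hs' (measure_ne_top _ _)
    have hlim : Tendsto (fun β : ℝ => exp (β * (s - s')) / q) atTop (𝓝 0) := by
      have : Tendsto (fun β : ℝ => exp (β * (s - s'))) atTop (𝓝 0) :=
        tendsto_exp_atBot.comp (tendsto_id.atTop_mul_const_of_neg (by linarith))
      simpa using this.div_const q
    obtain ⟨β, hβ1, hβ2, hβ3⟩ := ((hlim.eventually (gt_mem_nhds (show (0:ℝ) < 1 / 4 by norm_num))).and
      ((eventually_ge_atTop β0).and (eventually_ge_atTop 0))).exists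
    obtain ⟨hi, hA⟩ := h β hβ2
    have hA' := hA (X ⁻¹' Iic s) (hX measurableSet_Iic)
    have hle : (Q.tilted (fun x => β * X x)).real (X ⁻¹' Iic s) ≤ exp (β * (s - s')) / q := by
      rw [aux_real' Q X (hX measurableSet_Iic)]
      have hch := measure_ge_le_exp_mul_mgf s' hβ3 hi
      have hpos : 0 < mgf X Q β := mgf_pos hi
      rw [div_le_div_iff₀ hpos hqpos]
      calc _ ≤ exp (β * s) * (exp (-β * s') * mgf X Q β) :=
            mul_le_mul (aux_num Q X hX hβ3 hi s) hch hqpos.le (exp_pos _).le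
        _ = _ := by rw [← mul_assoc, ← exp_add]; congr 2; ring
    rw [abs_le] at hA'
    linarith [hA'.1]

lemma aux_fin (Q : Measure ℝ) [IsProbabilityMeasure Q] (b β0 : ℝ) (hβ0 : 0 ≤ β0) (hb : β0 < b)
    (hΓ : ∀ β, β < b → Integrable (fun x => exp (β * id x)) Q)
    (h : ∀ β, β0 ≤ β → β < b → ∀ A, MeasurableSet A →
      |(Q.tilted (fun x => β * id x)).real A - (Q.tilted (fun x => β0 * id x)).real A| ≤ 1 / 4) :
    Z Q b < ⊤ := by
  have hP := isProbabilityMeasure_tilted (hΓ β0 hb)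
  set P := Q.tilted (fun x => β0 * id x) with hPdef
  obtain ⟨M, hM1, hM0⟩ := (((tendsto_cdf_atTop P).eventually
    (lt_mem_nhds (show (1:ℝ)/2 < 1 by norm_num))).and (eventually_ge_atTop 0)).exists
  rw [cdf_eq_real] at hM1
  have hZ : ∀ β, β0 ≤ β → β < b → Z Q β ≤ ENNReal.ofReal (4 * exp (b * M)) := by
    intro β h1 h2
    have hA := h β h1 h2 (Iic M) measurableSet_Iic
    rw [abs_le] at hA
    have h3 : 1 / 4 ≤ (Q.tilted (fun x => β * id x)).real (Iic M) := by linarith [hA.1]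
    have hpos : 0 < mgf id Q β := mgf_pos (hΓ β h2)
    rw [aux_real' Q id measurableSet_Iic, le_div_iff₀ hpos] at h3
    have h4 := aux_num Q id measurable_id (hβ0.trans h1) (hΓ β h2) M
    rw [preimage_id] at h4
    have h5 : exp (β * M) ≤ exp (b * M) := exp_le_exp.2 (mul_le_mul_of_nonneg_right h2.le hM0)
    have h6 : β ∈ Γcan Q := by rw [aux_Γ]; exact hΓ β h2
    rw [← ENNReal.ofReal_toReal (LT.lt.ne h6), ← aux_mgf]
    exact ENNReal.ofReal_le_ofReal (by linarith)
  set u : ℕ → ℝ := fun n => b - (b - β0) * (1 / ((n : ℝ) + 1)) with hu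
  have hu1 : Tendsto u atTop (𝓝 b) := by
    simpa [hu] using (tendsto_one_div_add_atTop_nhds_zero_nat (𝕜 := ℝ)).const_mul (b - β0) |>.const_sub b
  have hul : ∀ n, β0 ≤ u n := by
    intro n
    have : 1 / ((n : ℝ) + 1) ≤ 1 := by
      rw [div_le_one (by positivity)]; linarith [n.cast_nonneg (α := ℝ)]
    simp only [hu]; nlinarith
  have hur : ∀ n, u n < b := by
    intro n
    have : 0 < (b - β0) * (1 / ((n : ℝ) + 1)) := mul_pos (by linarith) (by positivity)
    simp only [hu]; linarith
  have hfat : Z Q b ≤ liminf (fun n => Z Q (u n)) atTop := by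
    refine le_trans (le_of_eq ?_) (lintegral_liminf_le (μ := Q)
      (f := fun n x => ENNReal.ofReal (exp (u n * x))) (fun n => by fun_prop))
    rw [Z]
    congr 1; ext x
    refine (Tendsto.liminf_eq ?_).symm
    exact ENNReal.tendsto_ofReal ((continuous_exp.tendsto _).comp (hu1.mul_const x))
  refine lt_of_le_of_lt (hfat.trans ?_) (ENNReal.ofReal_lt_top (r := 4 * exp (b * M)))
  refine (liminf_le_liminf (Eventually.of_forall fun n => hZ (u n) (hul n) (hur n))).trans ?_
  simp

lemma aux_tail (ν : Measure ℝ) (hν : ν univ ≠ ⊤) (S : ℕ → Set ℝ) (hS : Antitone S)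
    (hm : ∀ n, MeasurableSet (S n)) (he : ⋂ n, S n = ∅) : ∃ n, ν (S n) < ENNReal.ofReal (1 / 4) := by
  have h := tendsto_measure_iInter_atTop (μ := ν) (s := S) (fun n => (hm n).nullMeasurableSet) hS
    ⟨0, measure_ne_top_of_subset (subset_univ _) hν⟩
  rw [he, measure_empty] at h
  exact (h.eventually (gt_mem_nhds (by simp))).exists

lemma aux_bd (Q : Measure ℝ) [IsProbabilityMeasure Q] (X : ℝ → ℝ) (hX : Measurable X) (c β x : ℝ)
    (hβ : 0 ≤ β) (hx : X x ≤ c) :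
    ENNReal.ofReal (exp (β * X x)) / (∫⁻ y, ENNReal.ofReal (exp (β * X y)) ∂Q)
      ≤ (Q (X ⁻¹' {c}))⁻¹ := by
  have h1 : ENNReal.ofReal (exp (β * c)) * Q (X ⁻¹' {c})
      ≤ ∫⁻ y, ENNReal.ofReal (exp (β * X y)) ∂Q := by
    have hms := hX (measurableSet_singleton c)
    rw [← setLIntegral_const]
    refine le_trans (le_of_eq ?_) (setLIntegral_le_lintegral (X ⁻¹' {c}) _)
    refine setLIntegral_congr_fun hms fun y hy => ?_
    have : X y = c := hy
    simp only [this]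
  have h2 : ENNReal.ofReal (exp (β * X x)) ≤ ENNReal.ofReal (exp (β * c)) :=
    ENNReal.ofReal_le_ofReal (exp_le_exp.2 (mul_le_mul_of_nonneg_left hx hβ))
  refine (ENNReal.div_le_div h2 h1).trans ?_
  have h3 : ENNReal.ofReal (exp (β * c)) ≠ 0 := by simp [exp_pos]
  rw [ENNReal.div_eq_inv_mul, ENNReal.mul_inv (Or.inl h3) (Or.inl ENNReal.ofReal_ne_top), mul_right_comm,
    ENNReal.inv_mul_cancel h3 ENNReal.ofReal_ne_top, one_mul]

/-- if the Shtarkov integral is infinite, so is the Jeffreys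
integral ∫_Γ √(I_β) dβ, where I_β = ψ''(β). -/
theorem shtarkov_infinite_implies_jeffreys_infinite (Q : Measure ℝ)
    [IsProbabilityMeasure Q] (hlt : LeftTruncated Q)
    (ψ' I : ℝ → ℝ)
    (hd1 : ∀ β ∈ interior (Γcan Q), HasDerivAt (ψ Q) (ψ' β) β)
    (hd2 : ∀ β ∈ interior (Γcan Q), HasDerivAt ψ' (I β) β)
    (hS : Shtarkov Q = ⊤) :
    ∫⁻ β in Γcan Q, ENNReal.ofReal (Real.sqrt (I β)) = ⊤ := by
  by_contra hJ
  set ν := (volume.restrict (Γcan Q)).withDensity fun β => ENNReal.ofReal √(I β) with hνdef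
  have hν : ν univ ≠ ⊤ := by
    rw [hνdef, withDensity_apply _ MeasurableSet.univ, Measure.restrict_univ]
    exact hJ
  have htv : ∀ s t, s ≤ t → Icc s t ⊆ interior (Γcan Q) → ν (Icc s t) ≤ ENNReal.ofReal (1 / 4) →
      ∀ A, MeasurableSet A →
      |(Q.tilted (fun x => t * id x)).real A - (Q.tilted (fun x => s * id x)).real A| ≤ 1 / 4 := by
    intro s t hst hsub hle A hA
    have := (aux_tv Q ψ' I hd1 hd2 hA hst hsub).trans hle
    exact (ENNReal.ofReal_le_ofReal_iff (by norm_num)).1 this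
  obtain ⟨a, ha⟩ := hlt
  have hint : ∀ β ∈ Γcan Q, Integrable (fun x => exp (β * id x)) Q := by
    intro β hβ
    rw [aux_Γ] at hβ
    exact hβ
  have h0 : (0 : ℝ) ∈ Γcan Q := by
    rw [aux_Γ]
    change Integrable (fun x => exp (0 * id x)) Q
    simp
  have hdown : ∀ β ∈ Γcan Q, ∀ β', β' ≤ β → β' ∈ Γcan Q := by
    intro β hβ β' hle
    rw [aux_Γ]
    change Integrable (fun x => exp (β' * id x)) Q
    refine ((hint β hβ).const_mul (exp ((β' - β) * a))).mono' (by fun_prop) ?_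
    filter_upwards [ha] with x hx
    rw [Real.norm_eq_abs, abs_of_pos (exp_pos _), ← exp_add]
    apply exp_le_exp.2
    simp only [id]
    nlinarith
  -- left end point
  obtain ⟨c, hc1, hc2⟩ : ∃ c, Q ((fun x : ℝ => -x) ⁻¹' {c}) ≠ 0 ∧ ∀ᵐ x ∂Q, -x ≤ c := by
    obtain ⟨n, hn⟩ := aux_tail ν hν (fun n => Iic (-(n : ℝ)))
      (fun m n h => Iic_subset_Iic.2 (neg_le_neg (Nat.cast_le.2 h))) (fun n => measurableSet_Iic) (by
        rw [eq_empty_iff_forall_notMem]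
        intro x hx
        obtain ⟨n, hn⟩ := exists_nat_gt (-x)
        have : x ≤ -(n : ℝ) := mem_iInter.1 hx n
        linarith)
    have hn0 : (0 : ℝ) ≤ n := n.cast_nonneg
    have hI0 : Iio (0 : ℝ) ⊆ interior (Γcan Q) :=
      interior_maximal (fun x hx => hdown 0 h0 x (le_of_lt hx)) isOpen_Iio
    have hcong : ∀ β : ℝ, (fun x : ℝ => β * -x) = fun x => (-β) * id x := by
      intro β; ext x; simp
    have hi : ∀ β : ℝ, 0 ≤ β → Integrable (fun x => exp (β * -x)) Q := by
      intro β hβ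
      have := hint (-β) (hdown 0 h0 _ (by linarith))
      simpa using this
    refine aux_top Q (fun x => -x) measurable_neg (n + 1) (hi _ (by linarith)) fun β hβ =>
      ⟨hi β (by linarith), fun A hA => ?_⟩
    rw [hcong, hcong, abs_sub_comm]
    refine htv _ _ (by linarith) ?_ ?_ A hA
    · intro x hx
      have := hx.2
      exact hI0 (show x < 0 by linarith)
    · refine (measure_mono ?_).trans hn.le
      intro x hx
      have := hx.2
      exact show x ≤ -(n : ℝ) by linarith
  have hleft : ∀ᵐ x ∂Q, ∀ β ≤ 0, ENNReal.ofReal (exp (β * x)) / Z Q β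
      ≤ (Q ((fun x : ℝ => -x) ⁻¹' {c}))⁻¹ := by
    filter_upwards [hc2] with x hx β hβ
    have := aux_bd Q (fun x => -x) measurable_neg c (-β) x (by linarith) hx
    simpa [Z] using this
  -- right end point
  obtain ⟨g, hg1, hg2⟩ : ∃ g : ℝ → ℝ≥0∞, ∫⁻ x, g x ∂Q ≠ ⊤ ∧ ∀ᵐ x ∂Q, ∀ β ∈ Γcan Q, 0 ≤ β →
      ENNReal.ofReal (exp (β * x)) / Z Q β ≤ g x := by
    by_cases hB : BddAbove (Γcan Q)
    · set b := sSup (Γcan Q) with hbdef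
      have hle : ∀ β ∈ Γcan Q, β ≤ b := fun β hβ => le_csSup hB hβ
      have hlt : ∀ β, β < b → β ∈ Γcan Q := by
        intro β hβ
        obtain ⟨u, hu, hu2⟩ := exists_lt_of_lt_csSup ⟨0, h0⟩ hβ
        exact hdown u hu β hu2.le
      have hIb : Iio b ⊆ interior (Γcan Q) := interior_maximal (fun x hx => hlt x hx) isOpen_Iio
      have hZb : Z Q b < ⊤ := by
        rcases (hle 0 h0).eq_or_lt with hb0 | hb0
        · rw [← hb0]; exact h0
        obtain ⟨n, hn⟩ := aux_tail ν hν (fun n => Ico (b - b * (1 / ((n : ℝ) + 1))) b)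
          (fun m n h => Ico_subset_Ico_left (by
            have := Nat.one_div_le_one_div (α := ℝ) h
            nlinarith)) (fun n => measurableSet_Ico) (by
            rw [eq_empty_iff_forall_notMem]
            intro x hx
            rw [mem_iInter] at hx
            have hxb : 0 < (b - x) / b := div_pos (sub_pos.2 (hx 0).2) hb0
            obtain ⟨n, hn⟩ := exists_nat_one_div_lt hxb
            have h1 := (hx n).1
            rw [lt_div_iff₀ hb0] at hn
            linarith)
        have hn1 : 1 / ((n : ℝ) + 1) ≤ 1 := by
          rw [div_le_one (by positivity)]; linarith [n.cast_nonneg (α := ℝ)]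
        have hn2 : 0 < b * (1 / ((n : ℝ) + 1)) := mul_pos hb0 (by positivity)
        refine aux_fin Q b (b - b * (1 / ((n : ℝ) + 1))) (by nlinarith) (by linarith)
          (fun β hβ => hint β (hlt β hβ)) fun β h1 h2 A hA => ?_
        refine htv _ _ h1 ?_ ?_ A hA
        · intro x hx
          exact hIb (lt_of_le_of_lt hx.2 h2)
        · refine (measure_mono ?_).trans hn.le
          intro x hx
          exact ⟨hx.1, lt_of_le_of_lt hx.2 h2⟩
      refine ⟨fun x => (1 + ENNReal.ofReal (exp (b * x))) / ENNReal.ofReal (exp (-(b * |a|))), ?_, ?_⟩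
      · simp_rw [div_eq_mul_inv]
        rw [lintegral_mul_const _ (by fun_prop), lintegral_add_left measurable_const]
        refine ENNReal.mul_ne_top (ENNReal.add_ne_top.2 ⟨by simp, hZb.ne⟩) ?_
        simp [exp_pos]
      · filter_upwards with x β hβ hβ0
        apply ENNReal.div_le_div
        · rcases le_total x 0 with hx | hx
          · refine le_add_right ?_
            rw [← ENNReal.ofReal_one]
            apply ENNReal.ofReal_le_ofReal
            rw [exp_le_one_iff]
            exact mul_nonpos_of_nonneg_of_nonpos hβ0 hx
          · refine le_add_left ?_
            exact ENNReal.ofReal_le_ofReal (exp_le_exp.2 (mul_le_mul_of_nonneg_right (hle β hβ) hx))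
        · have : ∫⁻ _, ENNReal.ofReal (exp (-(b * |a|))) ∂Q ≤ Z Q β := by
            refine lintegral_mono_ae ?_
            filter_upwards [ha] with y hy
            apply ENNReal.ofReal_le_ofReal (exp_le_exp.2 _)
            have h1 : β * |a| ≤ b * |a| := mul_le_mul_of_nonneg_right (hle β hβ) (abs_nonneg a)
            have h2 : β * a ≤ β * y := mul_le_mul_of_nonneg_left hy hβ0
            have h3 : β * (-|a|) ≤ β * a := mul_le_mul_of_nonneg_left (neg_abs_le a) hβ0
            linarith
          simpa using this
    · have huniv : ∀ β, β ∈ Γcan Q := by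
        intro β
        rw [not_bddAbove_iff] at hB
        obtain ⟨u, hu, hu2⟩ := hB β
        exact hdown u hu β hu2.le
      have hIu : ∀ β, β ∈ interior (Γcan Q) := by
        rw [eq_univ_of_forall huniv, interior_univ]; exact fun β => mem_univ β
      obtain ⟨n, hn⟩ := aux_tail ν hν (fun n => Ici (n : ℝ))
        (fun m n h => Ici_subset_Ici.2 (Nat.cast_le.2 h)) (fun n => measurableSet_Ici) (by
          rw [eq_empty_iff_forall_notMem]
          intro x hx
          obtain ⟨n, hn⟩ := exists_nat_gt x
          have : (n : ℝ) ≤ x := mem_iInter.1 hx n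
          linarith)
      obtain ⟨d, hd1', hd2'⟩ := aux_top Q id measurable_id n (hint _ (huniv _)) fun β hβ =>
        ⟨hint _ (huniv _), fun A hA => htv _ _ hβ (fun x _ => hIu x)
          ((measure_mono (fun x hx => hx.1)).trans hn.le) A hA⟩
      refine ⟨fun _ => (Q (id ⁻¹' {d}))⁻¹, ?_, ?_⟩
      · simpa using hd1'
      · filter_upwards [hd2'] with x hx β _ hβ
        exact aux_bd Q id measurable_id d β x hβ hx
  have hfin : Shtarkov Q ≤ ∫⁻ x, ((Q ((fun x : ℝ => -x) ⁻¹' {c}))⁻¹ + g x) ∂Q := by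
    refine lintegral_mono_ae ?_
    filter_upwards [hleft, hg2] with x h1 h2
    refine iSup₂_le fun β hβ => ?_
    rcases le_total β 0 with h | h
    · exact (h1 β h).trans (le_add_right le_rfl)
    · exact (h2 β hβ h).trans (le_add_left le_rfl)
  rw [hS, lintegral_add_left measurable_const, top_le_iff, ENNReal.add_eq_top] at hfin
  rcases hfin with h | h
  · rw [lintegral_const, measure_univ, mul_one, ENNReal.inv_eq_top] at h
    exact hc1 h
  · exact hg1 h
end
end

section
/- Let Q be a measure on ℝ with support I whose left end point is μ_inf, and suppose Q has density f(x) = (x − μ_inf)^{γ−1} g(x) (γ > 0) on an interval immediately to the right of μ_inf, where g is analytic and g(μ_inf) > 0, and Q has no point mass at μ_inf. Then the contribution of the left end to the Jeffreys integral ∫_M V(μ)^{-1/2} dμ is infinite, i.e., ∫_{μ_inf}^{μ₀} V(μ)^{-1/2} dμ = ∞ for μ₀ near μ_inf. -/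
open scoped ENNReal NNReal
open MeasureTheory Real Set Filter Topology Asymptotics ProbabilityTheory

noncomputable section

lemma shift_setLIntegral (F : ℝ → ℝ≥0∞) (a : ℝ) (s : Set ℝ) (hs : MeasurableSet s) :
    ∫⁻ x in {x | x - a ∈ s}, F (x - a) = ∫⁻ y in s, F y := by
  have hs' : MeasurableSet {x : ℝ | x - a ∈ s} := (measurable_id.sub_const a) hs
  rw [← lintegral_indicator hs, ← lintegral_indicator hs',
    ← lintegral_sub_right_eq_self (s.indicator F) a]
  rfl

lemma rpow_mul_exp_le {p u : ℝ} (hp : 0 < p) (hu : 0 < u) : u ^ p * Real.exp (-u) ≤ p ^ p := by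
  have h1 : u / p ≤ Real.exp (u / p) := by linarith [Real.add_one_le_exp (u / p)]
  have h2 : (u / p) ^ p ≤ Real.exp (u / p) ^ p :=
    Real.rpow_le_rpow (by positivity) h1 hp.le
  rw [← Real.exp_mul, div_mul_cancel₀ _ hp.ne', Real.div_rpow hu.le hp.le,
    div_le_iff₀ (by positivity)] at h2
  rw [Real.exp_neg, ← div_eq_mul_inv, div_le_iff₀ (Real.exp_pos _)]
  linarith

lemma dens_lintegral (a γ c δ t : ℝ) (hc : 0 < c) (k : ℕ) :
    ∫⁻ x, ENNReal.ofReal ((x - a) ^ k * Real.exp (-(t * (x - a))))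
      ∂((volume.restrict (Ioo a (a + δ))).withDensity
        (fun x => ENNReal.ofReal (c * (x - a) ^ (γ - 1))))
    = ∫⁻ y in Ioo 0 δ, ENNReal.ofReal (c * (y ^ (γ + k - 1) * Real.exp (-(t * y)))) := by
  rw [lintegral_withDensity_eq_lintegral_mul₀ (by fun_prop) (by fun_prop)]
  have hset : Ioo a (a + δ) = {x | x - a ∈ Ioo 0 δ} := by
    ext x; simp only [mem_Ioo, mem_ofPred_eq]; constructor <;> rintro ⟨h1, h2⟩ <;> constructor <;> linarith
  rw [hset]
  have := shift_setLIntegral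
    (fun y => ENNReal.ofReal (c * y ^ (γ - 1)) * ENNReal.ofReal (y ^ k * Real.exp (-(t * y)))) a
    (Ioo 0 δ) measurableSet_Ioo
  simp only [Pi.mul_apply]
  rw [this]
  refine setLIntegral_congr_fun measurableSet_Ioo ?_
  intro y hy
  have hy0 : 0 < y := hy.1
  simp only
  rw [← ENNReal.ofReal_mul (by positivity)]
  congr 1
  rw [show γ + k - 1 = (γ - 1) + k by ring, Real.rpow_add hy0, Real.rpow_natCast]
  ring

lemma lower_bd (Q : Measure ℝ) (a γ c δ : ℝ) (hγ : 0 < γ) (hc : 0 < c) (hδ : 0 < δ)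
    (hl : (volume.restrict (Ioo a (a + δ))).withDensity
        (fun x => ENNReal.ofReal (c * (x - a) ^ (γ - 1))) ≤ Q.restrict (Ioo a (a + δ)))
    (k : ℕ) : ∃ c' > 0, ∀ t ≥ 1 / δ, ENNReal.ofReal (c' * (1 / t) ^ (γ + k)) ≤
      ∫⁻ x, ENNReal.ofReal ((x - a) ^ k * Real.exp (-(t * (x - a)))) ∂Q := by
  have hp : 0 < γ + k := by positivity
  refine ⟨c * Real.exp (-1) / (γ + k), by positivity, fun t ht => ?_⟩
  have ht0 : 0 < t := lt_of_lt_of_le (by positivity) ht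
  have htd : 1 / t ≤ δ := by
    rw [div_le_iff₀ ht0]; rw [ge_iff_le, div_le_iff₀ hδ] at ht; linarith
  have h1t : 0 < 1 / t := by positivity
  refine le_trans ?_ (setLIntegral_le_lintegral (Ioo a (a + δ)) _)
  refine le_trans ?_ (lintegral_mono' hl le_rfl)
  rw [dens_lintegral a γ c δ t hc k]
  refine le_trans ?_ (lintegral_mono_set (Ioo_subset_Ioo_right htd))
  have hint : IntegrableOn (fun y : ℝ => c * Real.exp (-1) * y ^ (γ + k - 1)) (Ioo 0 (1 / t)) := by
    have := (intervalIntegral.intervalIntegrable_rpow' (a := 0) (b := 1 / t)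
      (r := γ + k - 1) (by linarith)).const_mul (c * Real.exp (-1))
    rw [intervalIntegrable_iff_integrableOn_Ioo_of_le h1t.le] at this
    exact this
  have hval : c * Real.exp (-1) / (γ + k) * (1 / t) ^ (γ + k) =
      ∫ y in Ioo 0 (1 / t), c * Real.exp (-1) * y ^ (γ + k - 1) := by
    rw [← integral_Ioc_eq_integral_Ioo, ← intervalIntegral.integral_of_le h1t.le,
      intervalIntegral.integral_const_mul, integral_rpow (Or.inl (by linarith))]
    rw [show γ + k - 1 + 1 = γ + k by ring, Real.zero_rpow hp.ne']
    ring
  rw [hval, ofReal_integral_eq_lintegral_ofReal hint]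
  · refine setLIntegral_mono' measurableSet_Ioo ?_
    intro y hy
    have hy0 : 0 < y := hy.1
    apply ENNReal.ofReal_le_ofReal
    have : Real.exp (-1) ≤ Real.exp (-(t * y)) := by
      apply Real.exp_le_exp.mpr
      have := hy.2
      rw [lt_div_iff₀ ht0] at this
      linarith
    have h3 : 0 < y ^ (γ + k - 1) := by positivity
    calc c * Real.exp (-1) * y ^ (γ + k - 1) = c * (y ^ (γ + k - 1) * Real.exp (-1)) := by ring
      _ ≤ _ := by gcongr
  · filter_upwards [ae_restrict_mem measurableSet_Ioo] with y hy
    have hy0 : 0 < y := hy.1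
    simp only [Pi.zero_apply]
    positivity

lemma upper_bd (Q : Measure ℝ) [IsProbabilityMeasure Q] (a γ c δ : ℝ) (hγ : 0 < γ) (hc : 0 < c)
    (hδ : 0 < δ) (hQ : Q (Iic a) = 0)
    (hu : Q.restrict (Ioo a (a + δ)) ≤ (volume.restrict (Ioo a (a + δ))).withDensity
        (fun x => ENNReal.ofReal (c * (x - a) ^ (γ - 1))))
    (k : ℕ) : ∃ C > 0, ∀ t > 0,
      ∫⁻ x, ENNReal.ofReal ((x - a) ^ k * Real.exp (-(t * (x - a)))) ∂Q ≤
        ENNReal.ofReal (C * (1 / t) ^ (γ + k)) := by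
  have hp : 0 < γ + k := by positivity
  have hG : 0 < Real.Gamma (γ + k) := Real.Gamma_pos_of_pos hp
  refine ⟨c * Real.Gamma (γ + k) + (γ + k) ^ (γ + k) / δ ^ γ, by positivity, fun t ht => ?_⟩
  have huniv : (univ : Set ℝ) ⊆ Iic a ∪ (Ioo a (a + δ) ∪ Ici (a + δ)) := by
    intro x _
    simp only [mem_union, mem_Iic, mem_Ioo, mem_Ici]
    grind
  rw [← setLIntegral_univ]
  refine (lintegral_mono_set huniv).trans ?_
  refine (lintegral_union_le _ _ _).trans ?_
  rw [setLIntegral_measure_zero _ _ hQ, zero_add]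
  refine (lintegral_union_le _ _ _).trans ?_
  rw [add_mul, ENNReal.ofReal_add (by positivity) (by positivity)]
  apply add_le_add
  · refine (lintegral_mono' hu le_rfl).trans ?_
    rw [dens_lintegral a γ c δ t hc k]
    refine (lintegral_mono_set Ioo_subset_Ioi_self).trans ?_
    have hint : IntegrableOn (fun y : ℝ => c * (y ^ (γ + k - 1) * Real.exp (-(t * y)))) (Ioi 0) := by
      have := integrableOn_rpow_mul_exp_neg_mul_rpow (p := 1) (s := γ + k - 1) (b := t)
        (by linarith) one_pos ht
      simp only [Real.rpow_one, neg_mul] at this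
      exact this.const_mul c
    rw [← ofReal_integral_eq_lintegral_ofReal hint]
    · rw [integral_const_mul, Real.integral_rpow_mul_exp_neg_mul_Ioi hp ht]
      apply ENNReal.ofReal_le_ofReal
      apply le_of_eq; ring
    · filter_upwards [ae_restrict_mem measurableSet_Ioi] with y hy
      have hy0 : 0 < y := hy
      simp only [Pi.zero_apply]
      positivity
  · have hb : ∀ x ∈ Ici (a + δ), ENNReal.ofReal ((x - a) ^ k * Real.exp (-(t * (x - a)))) ≤
        ENNReal.ofReal ((γ + k) ^ (γ + k) / δ ^ γ * (1 / t) ^ (γ + k)) := by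
      intro x hx
      apply ENNReal.ofReal_le_ofReal
      have hy : δ ≤ x - a := by have : a + δ ≤ x := hx; linarith
      set y := x - a
      have hy0 : 0 < y := by linarith
      have h := rpow_mul_exp_le hp (mul_pos ht hy0)
      have h2 : δ ^ γ ≤ y ^ γ := Real.rpow_le_rpow hδ.le hy hγ.le
      rw [Real.mul_rpow ht.le hy0.le, Real.rpow_add hy0, Real.rpow_natCast] at h
      rw [Real.div_rpow zero_le_one ht.le, Real.one_rpow, div_mul_div_comm, mul_one,
        le_div_iff₀ (by positivity)]
      refine le_trans ?_ h
      have h3 : 0 ≤ y ^ k * Real.exp (-(t * y)) * t ^ (γ + k) := by positivity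
      nlinarith
    refine (setLIntegral_mono' measurableSet_Ici hb).trans ?_
    rw [setLIntegral_const]
    calc _ ≤ ENNReal.ofReal ((γ + k) ^ (γ + k) / δ ^ γ * (1 / t) ^ (γ + k)) * 1 := by
          gcongr; exact prob_le_one
      _ = _ := mul_one _

/-- Real-valued version of the Laplace moment bounds. -/
lemma both_bd (Q : Measure ℝ) [IsProbabilityMeasure Q] (a γ c₁ c₂ δ : ℝ) (hγ : 0 < γ)
    (hc₁ : 0 < c₁) (hc₂ : 0 < c₂) (hδ : 0 < δ) (hQ : Q (Iic a) = 0)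
    (hl : (volume.restrict (Ioo a (a + δ))).withDensity
        (fun x => ENNReal.ofReal (c₁ * (x - a) ^ (γ - 1))) ≤ Q.restrict (Ioo a (a + δ)))
    (hu : Q.restrict (Ioo a (a + δ)) ≤ (volume.restrict (Ioo a (a + δ))).withDensity
        (fun x => ENNReal.ofReal (c₂ * (x - a) ^ (γ - 1))))
    (k : ℕ) : ∃ c > 0, ∃ C > 0, ∀ t ≥ 1 / δ,
      c * (1 / t) ^ (γ + k) ≤ ∫ x, (x - a) ^ k * Real.exp (-(t * (x - a))) ∂Q ∧
      ∫ x, (x - a) ^ k * Real.exp (-(t * (x - a))) ∂Q ≤ C * (1 / t) ^ (γ + k) := by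
  obtain ⟨c, hc, h1⟩ := lower_bd Q a γ c₁ δ hγ hc₁ hδ hl k
  obtain ⟨C, hC, h2⟩ := upper_bd Q a γ c₂ δ hγ hc₂ hδ hQ hu k
  refine ⟨c, hc, C, hC, fun t ht => ?_⟩
  have ht0 : 0 < t := lt_of_lt_of_le (by positivity) ht
  have hae : ∀ᵐ x ∂Q, a < x := by
    filter_upwards [measure_eq_zero_iff_ae_notMem.mp hQ] with x hx
    simpa using hx
  rw [integral_eq_lintegral_of_nonneg_ae]
  · constructor
    · rw [← ENNReal.ofReal_le_iff_le_toReal]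
      · exact h1 t ht
      · exact ((h2 t ht0).trans_lt ENNReal.ofReal_lt_top).ne
    · exact ENNReal.toReal_le_of_le_ofReal (by positivity) (h2 t ht0)
  · filter_upwards [hae] with x hx
    have : 0 < x - a := by linarith
    simp only [Pi.zero_apply]
    positivity
  · exact Measurable.aestronglyMeasurable (by fun_prop)

lemma Γcan_eq (Q : Measure ℝ) : Γcan Q = integrableExpSet (fun x => x) Q := by
  ext β
  have hm : AEStronglyMeasurable (fun x : ℝ => Real.exp (β * x)) Q :=
    Measurable.aestronglyMeasurable (by fun_prop)
  have h := hasFiniteIntegral_iff_ofReal (μ := Q) (f := fun x : ℝ => Real.exp (β * x))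
    (Eventually.of_forall fun x => (Real.exp_pos _).le)
  constructor
  · intro hb
    exact ⟨hm, h.mpr hb⟩
  · intro hb
    exact h.mp hb.2

lemma Pexp_eq_s13 (Q : Measure ℝ) [IsProbabilityMeasure Q] (β : ℝ)
    (hb : Integrable (fun x => Real.exp (β * x)) Q) :
    Pexp Q β = Q.tilted (fun x => β * x) := by
  have hZ : Z Q β = ENNReal.ofReal (∫ x, Real.exp (β * x) ∂Q) := by
    rw [ofReal_integral_eq_lintegral_ofReal hb (Eventually.of_forall fun x => (Real.exp_pos _).le)]
    rfl
  have hpos : 0 < ∫ x, Real.exp (β * x) ∂Q := integral_exp_pos hb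
  unfold Pexp Measure.tilted
  rw [hZ]
  congr 1
  ext x
  rw [ENNReal.ofReal_div_of_pos hpos]

lemma moment_tilted (Q : Measure ℝ) (a t : ℝ) (k : ℕ) :
    ∫ x, (x - a) ^ k ∂(Q.tilted (fun x => -t * x)) =
      (∫ x, (x - a) ^ k * Real.exp (-(t * (x - a))) ∂Q) /
        ∫ x, (x - a) ^ 0 * Real.exp (-(t * (x - a))) ∂Q := by
  have h : ∀ x, Real.exp (-t * x) = Real.exp (-t * a) * Real.exp (-(t * (x - a))) := by
    intro x; rw [← Real.exp_add]; congr 1; ring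
  rw [integral_tilted]
  have h0 : ∫ x, Real.exp (-t * x) ∂Q = Real.exp (-t * a) *
      ∫ x, (x - a) ^ 0 * Real.exp (-(t * (x - a))) ∂Q := by
    rw [← integral_const_mul]
    congr 1
    ext x
    rw [h x, pow_zero, one_mul]
  rw [h0]
  rw [← integral_div]
  congr 1
  ext x
  rw [h x, smul_eq_mul, mul_div_mul_left _ _ (Real.exp_pos _).ne']
  ring

lemma not_const (Q : Measure ℝ) [IsProbabilityMeasure Q] (a : ℝ) (hsupp : Q (Iio a) = 0)
    (hpos : ∀ ε > 0, 0 < Q (Ico a (a + ε))) (hatom : Q {a} = 0) (c : ℝ) :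
    ¬ (∀ᵐ x ∂Q, x = c) := by
  intro h
  rcases le_or_gt c a with hca | hca
  · have h1 : ∀ᵐ x ∂Q, False := by
      filter_upwards [h, measure_eq_zero_iff_ae_notMem.mp hsupp,
        measure_eq_zero_iff_ae_notMem.mp hatom] with x hx h2 h3
      simp only [mem_Iio, not_lt, mem_singleton_iff] at h2 h3
      apply h3
      linarith
    rw [eventually_false_iff_eq_bot, ae_eq_bot] at h1
    exact IsProbabilityMeasure.ne_zero Q h1
  · refine (hpos (c - a) (by linarith)).ne' ?_
    rw [measure_eq_zero_iff_ae_notMem]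
    filter_upwards [h] with x hx h2
    have := h2.2
    linarith

lemma lintegral_inv_top (a b C : ℝ) (hab : a < b) (hC : 0 < C) :
    ∫⁻ x in Ioo a b, ENNReal.ofReal (1 / (C * (x - a))) = ⊤ := by
  by_contra hne
  have hI : IntegrableOn (fun x => 1 / (C * (x - a))) (Ioo a b) := by
    refine ⟨Measurable.aestronglyMeasurable (by fun_prop), ?_⟩
    rw [hasFiniteIntegral_iff_ofReal]
    · exact lt_top_iff_ne_top.mpr hne
    · filter_upwards [ae_restrict_mem measurableSet_Ioo] with x hx
      have : 0 < x - a := by linarith [hx.1]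
      simp only [Pi.zero_apply]
      positivity
  have h2 : IntervalIntegrable (fun x => (x - a)⁻¹) volume a b := by
    rw [intervalIntegrable_iff_integrableOn_Ioo_of_le hab.le]
    refine (hI.const_mul C).congr ?_
    filter_upwards with x
    field_simp
  rw [intervalIntegrable_sub_inv_iff] at h2
  rcases h2 with h2 | h2
  · exact hab.ne h2
  · exact h2 left_mem_uIcc

/-- Sandwiching of `Q` near the left end point. -/
lemma sandwich (Q : Measure ℝ) (a : ℝ) (γ : ℝ) (g : ℝ → ℝ) (ε : ℝ) (hε : 0 < ε)
    (hg : AnalyticOn ℝ g (Icc a (a + ε))) (hga : 0 < g a)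
    (hdens : Q.restrict (Ioo a (a + ε)) =
      (volume.withDensity
        (fun x => ENNReal.ofReal ((x - a) ^ (γ - 1) * g x))).restrict
          (Ioo a (a + ε))) :
    ∃ δ > 0, (volume.restrict (Ioo a (a + δ))).withDensity
        (fun x => ENNReal.ofReal (g a / 2 * (x - a) ^ (γ - 1))) ≤ Q.restrict (Ioo a (a + δ)) ∧
      Q.restrict (Ioo a (a + δ)) ≤ (volume.restrict (Ioo a (a + δ))).withDensity
        (fun x => ENNReal.ofReal (2 * g a * (x - a) ^ (γ - 1))) := by
  have hcont : ContinuousWithinAt g (Icc a (a + ε)) a :=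
    hg.continuousOn a ⟨le_rfl, by linarith⟩
  have hnear : ∀ᶠ x in 𝓝[Icc a (a + ε)] a, g a / 2 < g x ∧ g x < 2 * g a :=
    (hcont.eventually (lt_mem_nhds (by linarith))).and
      (hcont.eventually (gt_mem_nhds (by linarith)))
  rw [eventually_nhdsWithin_iff, Metric.eventually_nhds_iff] at hnear
  obtain ⟨r, hr, hnear⟩ := hnear
  refine ⟨min r ε, lt_min hr hε, ?_⟩
  set δ := min r ε
  have hsub : Ioo a (a + δ) ⊆ Ioo a (a + ε) :=
    Ioo_subset_Ioo_right (by linarith [min_le_right r ε])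
  have hgx : ∀ x ∈ Ioo a (a + δ), g a / 2 < g x ∧ g x < 2 * g a := by
    intro x hx
    apply hnear
    · rw [Real.dist_eq, abs_of_pos (by linarith [hx.1])]
      linarith [hx.2, min_le_left r ε]
    · exact Ioo_subset_Icc_self (hsub hx)
  have hQ : Q.restrict (Ioo a (a + δ)) = (volume.restrict (Ioo a (a + δ))).withDensity
        (fun x => ENNReal.ofReal ((x - a) ^ (γ - 1) * g x)) := by
    rw [← restrict_withDensity measurableSet_Ioo, ← Measure.restrict_restrict_of_subset hsub, hdens,
      Measure.restrict_restrict_of_subset hsub]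
  rw [hQ]
  constructor
  · apply withDensity_mono
    filter_upwards [ae_restrict_mem measurableSet_Ioo] with x hx
    apply ENNReal.ofReal_le_ofReal
    have : 0 < x - a := by linarith [hx.1]
    rw [mul_comm]
    gcongr
    exact (hgx x hx).1.le
  · apply withDensity_mono
    filter_upwards [ae_restrict_mem measurableSet_Ioo] with x hx
    apply ENNReal.ofReal_le_ofReal
    have : 0 < x - a := by linarith [hx.1]
    rw [mul_comm (2 * g a)]
    gcongr
    exact (hgx x hx).2.le

/-- if Q has no point mass at the left end point a of its support
and has density (x−a)^{γ−1} g(x) with g analytic, g(a) > 0 near a, then the left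
end contributes infinitely to the Jeffreys integral in mean-value
parametrization. -/
theorem jeffreys_left_end_infinite (Q : Measure ℝ) [IsProbabilityMeasure Q]
    (a : ℝ)
    -- a is the left end point of the support of Q
    (hsupp : Q (Iio a) = 0) (hpos : ∀ ε > 0, 0 < Q (Ico a (a + ε)))
    -- density near a
    (γ : ℝ) (hγ : 0 < γ) (g : ℝ → ℝ) (ε : ℝ) (hε : 0 < ε)
    (hg : AnalyticOn ℝ g (Icc a (a + ε))) (hga : 0 < g a)
    (hdens : Q.restrict (Ioo a (a + ε)) =
      (volume.withDensity
        (fun x => ENNReal.ofReal ((x - a) ^ (γ - 1) * g x))).restrict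
          (Ioo a (a + ε)))
    -- no point mass at a
    (hatom : Q {a} = 0)
    -- mean-value parametrization and variance function
    (m V : ℝ → ℝ)
    (hm : ∀ β ∈ interior (Γcan Q), m β = ∫ x, x ∂(Pexp Q β))
    (hV : ∀ β ∈ interior (Γcan Q),
      V (m β) = variance (fun x => x) (Pexp Q β)) :
    ∀ μ₀ ∈ m '' interior (Γcan Q),
      ∫⁻ μ in Ioo a μ₀, ENNReal.ofReal (1 / Real.sqrt (V μ)) = ⊤ := by
  intro μ₀ hμ₀
  have hQ : Q (Iic a) = 0 := by
    rw [← Iio_union_right, measure_union_null_iff]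
    exact ⟨hsupp, hatom⟩
  have hae : ∀ᵐ x ∂Q, a < x := by
    filter_upwards [measure_eq_zero_iff_ae_notMem.mp hQ] with x hx
    simpa using hx
  have hnc := not_const Q a hsupp hpos hatom
  rw [Γcan_eq] at hm hV hμ₀
  set S := interior (integrableExpSet (fun x : ℝ => x) Q) with hS
  have hint : ∀ β ∈ S, Integrable (fun x => Real.exp (β * x)) Q := fun β hβ =>
    (interior_subset hβ : β ∈ integrableExpSet (fun x : ℝ => x) Q)
  have hprob : ∀ β ∈ S, IsProbabilityMeasure (Q.tilted (fun x => β * x)) := fun β hβ =>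
    isProbabilityMeasure_tilted (hint β hβ)
  have hmem : ∀ β ∈ S, MemLp (fun x : ℝ => x) 2 (Q.tilted (fun x => β * x)) := fun β hβ => by
    simpa using memLp_tilted_mul (X := fun x : ℝ => x) hβ 2
  have hm' : ∀ β ∈ S, m β = ∫ x, x ∂(Q.tilted (fun x => β * x)) := fun β hβ => by
    rw [hm β hβ, Pexp_eq_s13 Q β (hint β hβ)]
  have hV' : ∀ β ∈ S, V (m β) = variance (fun x => x) (Q.tilted (fun x => β * x)) :=
    fun β hβ => by rw [hV β hβ, Pexp_eq_s13 Q β (hint β hβ)]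
  have hId : ∀ β ∈ S, Integrable (fun x : ℝ => x) (Q.tilted (fun x => β * x)) := fun β hβ =>
    have := hprob β hβ
    (hmem β hβ).integrable (by norm_num)
  have hma : ∀ β ∈ S, m β - a = ∫ x, (x - a) ∂(Q.tilted (fun x => β * x)) := fun β hβ => by
    have := hprob β hβ
    rw [integral_sub (hId β hβ) (integrable_const _), hm' β hβ]
    simp
  -- the mean is larger than `a`
  have hgt : ∀ β ∈ S, a < m β := by
    intro β hβ
    have := hprob β hβ
    have h0 : 0 ≤ᵐ[Q.tilted (fun x => β * x)] fun x => x - a := by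
      filter_upwards [(tilted_absolutelyContinuous Q _).ae_le hae] with x hx
      simp only [Pi.zero_apply]; linarith
    have h1 : 0 ≤ m β - a := by rw [hma β hβ]; exact integral_nonneg_of_ae h0
    rcases h1.lt_or_eq with h | h
    · linarith
    · exfalso
      have h2 := (integral_eq_zero_iff_of_nonneg_ae h0
        ((hId β hβ).sub (integrable_const _))).mp (by rw [← hma β hβ]; exact h.symm)
      apply hnc a
      filter_upwards [(absolutelyContinuous_tilted (hint β hβ)).ae_le h2] with x hx
      simp only [Pi.zero_apply] at hx; linarith
  -- the variance is positive
  have hVpos : ∀ β ∈ S, 0 < V (m β) := by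
    intro β hβ
    have := hprob β hβ
    rw [hV' β hβ]
    refine (variance_nonneg _ _).lt_of_ne' fun h0 => ?_
    have h1 : evariance (fun x : ℝ => x) (Q.tilted (fun x => β * x)) = 0 := by
      rw [← (hmem β hβ).ofReal_variance_eq, h0, ENNReal.ofReal_zero]
    rw [evariance_eq_zero_iff aemeasurable_id'] at h1
    apply hnc (∫ x, x ∂(Q.tilted (fun x => β * x)))
    exact (absolutelyContinuous_tilted (hint β hβ)).ae_le h1
  -- negative parameters are admissible
  have hneg : Iio (0 : ℝ) ⊆ S := by
    rw [hS, isOpen_Iio.subset_interior_iff]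
    intro β hβ
    have hb : β < 0 := hβ
    refine Integrable.of_bound (C := Real.exp (β * a))
      (Measurable.aestronglyMeasurable (by fun_prop)) ?_
    filter_upwards [hae] with x hx
    rw [Real.norm_of_nonneg (Real.exp_pos _).le]
    apply Real.exp_le_exp.mpr
    nlinarith
  -- continuity of the mean
  have hcont : ContinuousOn m S := by
    have h1 : ContinuousOn (deriv (cgf (fun x : ℝ => x) Q)) S :=
      (analyticOnNhd_cgf (X := fun x : ℝ => x) (μ := Q)).deriv.continuousOn
    refine h1.congr fun β hβ => ?_
    rw [hm' β hβ]
    exact integral_tilted_mul_self hβ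
  obtain ⟨δ, hδ, hl, hu⟩ := sandwich Q a γ g ε hε hg hga hdens
  have B := both_bd Q a γ (g a / 2) (2 * g a) δ hγ (by positivity) (by positivity) hδ hQ hl hu
  obtain ⟨c0, hc0, C0, hC0, B0⟩ := B 0
  obtain ⟨c1, hc1, C1, hC1, B1⟩ := B 1
  obtain ⟨c2, hc2, C2, hC2, B2⟩ := B 2
  have hTneg : ∀ t ≥ 1 / δ, -t ∈ S := fun t ht => hneg (by
    have : 0 < 1 / δ := by positivity
    simp only [mem_Iio]; linarith)
  have hm1 : ∀ t ≥ 1 / δ, m (-t) - a ≤ C1 / c0 * (1 / t) := by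
    intro t ht
    have ht0 : 0 < t := lt_of_lt_of_le (by positivity) ht
    have h := moment_tilted Q a t 1
    have hp : 0 < (1 / t) ^ γ := by positivity
    have b0 := (B0 t ht).1
    have b1 := (B1 t ht).2
    rw [Real.rpow_add (by positivity)] at b0 b1
    norm_num only [Nat.cast_zero, Nat.cast_one, Real.rpow_zero, Real.rpow_one] at b0 b1
    simp only [pow_one] at h b1
    rw [hma (-t) (hTneg t ht), h]
    rw [div_le_iff₀ (lt_of_lt_of_le (by positivity) b0)]
    refine b1.trans ?_
    calc _ = C1 / c0 * (1 / t) * (c0 * ((1 / t) ^ γ * 1)) := by field_simp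
      _ ≤ _ := by gcongr
  set K := C2 * C0 / c1 ^ 2 with hK
  have hKpos : 0 < K := by positivity
  have hVle : ∀ t ≥ 1 / δ, V (m (-t)) ≤ K * (m (-t) - a) ^ 2 := by
    intro t ht
    have ht0 : 0 < t := lt_of_lt_of_le (by positivity) ht
    have := hprob (-t) (hTneg t ht)
    have hv : V (m (-t)) ≤ ∫ x, (x - a) ^ 2 ∂(Q.tilted (fun x => -t * x)) := by
      rw [hV' (-t) (hTneg t ht), ← variance_sub_const (X := fun x : ℝ => x) aestronglyMeasurable_id a]
      exact variance_le_expectation_sq (X := fun x : ℝ => x - a)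
        (Measurable.aestronglyMeasurable (by fun_prop))
    refine hv.trans ?_
    have h1 := moment_tilted Q a t 1
    have h2 := moment_tilted Q a t 2
    have hp : 0 < (1 / t) ^ γ := by positivity
    obtain ⟨b0, b0'⟩ := B0 t ht
    have b1 := (B1 t ht).1
    have b2 := (B2 t ht).2
    rw [Real.rpow_add (by positivity), Real.rpow_natCast] at b0 b0' b1 b2
    rw [h2, hma (-t) (hTneg t ht)]
    have h1' : ∫ x, (x - a) ∂(Q.tilted (fun x => -t * x)) =
      ∫ x, (x - a) ^ 1 ∂(Q.tilted (fun x => -t * x)) := by simp only [pow_one]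
    rw [h1', h1]
    set L0 := ∫ x, (x - a) ^ 0 * Real.exp (-(t * (x - a))) ∂Q
    set L1 := ∫ x, (x - a) ^ 1 * Real.exp (-(t * (x - a))) ∂Q
    set L2 := ∫ x, (x - a) ^ 2 * Real.exp (-(t * (x - a))) ∂Q
    set u := (1 / t) ^ γ
    set s := 1 / t
    have hs : 0 < s := by positivity
    have hL0 : 0 < L0 := lt_of_lt_of_le (by positivity) b0
    rw [div_le_iff₀ hL0]
    have e : K * (L1 / L0) ^ 2 * L0 = K * L1 ^ 2 / L0 := by field_simp
    rw [e, le_div_iff₀ hL0]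
    calc L2 * L0 ≤ (C2 * (u * s ^ 2)) * (C0 * (u * s ^ 0)) := by gcongr
      _ = K * (c1 * (u * s ^ 1)) ^ 2 := by rw [hK]; field_simp
      _ ≤ K * L1 ^ 2 := by gcongr
  -- every mean close to `a` is attained
  obtain ⟨β₀, hβ₀, rfl⟩ := hμ₀
  have hT : -(1 / δ) ∈ S := hTneg _ le_rfl
  set b := min (m β₀) (m (-(1 / δ))) with hb
  have hab : a < b := lt_min (hgt _ hβ₀) (hgt _ hT)
  have hatt : ∀ μ ∈ Ioo a b, ∃ t ≥ 1 / δ, m (-t) = μ := by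
    intro μ hμ
    have hμa : 0 < μ - a := by linarith [hμ.1]
    set t₁ := max (1 / δ) (C1 / c0 / (μ - a)) with ht₁
    have ht1 : 1 / δ ≤ t₁ := le_max_left _ _
    have ht10 : 0 < t₁ := lt_of_lt_of_le (by positivity) ht1
    have hlow : m (-t₁) ≤ μ := by
      have h1 := hm1 t₁ ht1
      have h2 : C1 / c0 / (μ - a) ≤ t₁ := le_max_right _ _
      rw [div_le_iff₀ hμa] at h2
      have h3 : C1 / c0 * (1 / t₁) ≤ μ - a := by
        rw [mul_one_div, div_le_iff₀ ht10]; linarith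
      linarith
    have hsubS : Icc (-t₁) (-(1 / δ)) ⊆ S := by
      intro β hβ
      have := hTneg (-β) (by linarith [hβ.2])
      simpa using this
    obtain ⟨β, hβ, hβμ⟩ := intermediate_value_Icc (by linarith) (hcont.mono hsubS)
      ⟨hlow, (hμ.2.trans_le (min_le_right _ _)).le⟩
    exact ⟨-β, by linarith [hβ.2], by simpa using hβμ⟩
  rw [eq_top_iff, ← lintegral_inv_top a b (Real.sqrt K) hab (by positivity)]
  refine le_trans ?_ (lintegral_mono_set (Ioo_subset_Ioo_right (min_le_left (m β₀) (m (-(1 / δ))))))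
  refine setLIntegral_mono' measurableSet_Ioo fun μ hμ => ?_
  obtain ⟨t, ht, rfl⟩ := hatt μ hμ
  apply ENNReal.ofReal_le_ofReal
  have hv := hVle t ht
  have hvp := hVpos _ (hTneg t ht)
  have hma0 : 0 < m (-t) - a := by linarith [hμ.1]
  apply one_div_le_one_div_of_le (Real.sqrt_pos.mpr hvp)
  calc Real.sqrt (V (m (-t))) ≤ Real.sqrt (K * (m (-t) - a) ^ 2) := Real.sqrt_le_sqrt hv
    _ = _ := by rw [Real.sqrt_mul hKpos.le, Real.sqrt_sq hma0.le]
end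
end
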